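/- arXiv:hep-th/0207212 — 10 statements merged into one kernel-verified Lean document; each statement's English description precedes it below -/
import Mathlib

section
/- Gauge-invariance constraints for the undeformed spin-s generating polynomial (eqs. (baseq25), (baseq35)): with the notation of the context, define the polynomial P : ℝ^d × ℝ^d × ℝ^d → ℝ by P(q,q',n) = Σ_{k=0}^{j} r_k · τ^{2k+ς} · (ρ²ρ'²)^{j−k}. Then for all (q,q',n): (i) the Laplacian of P in the variable q vanishes, Σ_{m=1}^d ∂²P/∂q^m∂q^m = 0; (ii) the Laplacian of P in the variable q' vanishes; (iii) Σ_{m=1}^d n^m ∂P/∂q^m = 0; and (iv) Σ_{m=1}^d n^m ∂P/∂q'^m = 0. -/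
namespace Stmt0

/-- the standard inner product on `ℝ^d` -/
noncomputable def ip {d : ℕ} (a b : Fin d → ℝ) : ℝ := ∑ m, a m * b m

/-- `ρ² = ‖n‖²‖q‖² − ⟨q,n⟩²` -/
noncomputable def rho2 {d : ℕ} (q n : Fin d → ℝ) : ℝ := ip n n * ip q q - (ip q n) ^ 2

/-- `τ = ‖n‖²⟨q,q'⟩ − ⟨q,n⟩⟨q',n⟩` -/
noncomputable def tau {d : ℕ} (q q' n : Fin d → ℝ) : ℝ :=
  ip n n * ip q q' - ip q n * ip q' n

/-- the coefficients `r_k` -/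
noncomputable def rcoef (d s k : ℕ) : ℝ :=
  ((-1 : ℝ) ^ k / (Nat.factorial (2 * k + s % 2) : ℝ)) *
    (∏ i ∈ Finset.range k, ((s : ℝ) - ((s % 2 : ℕ) : ℝ) - 2 * (i : ℝ))) *
    (∏ i ∈ Finset.range k, ((s : ℝ) + ((s % 2 : ℕ) : ℝ) + (d : ℝ) - 5 + 2 * ((i : ℝ) + 1)))

/-- the generating polynomial `P(q,q',n) = Σ_{k=0}^{j} r_k τ^{2k+ς} (ρ²ρ'²)^{j−k}` -/
noncomputable def P (d s : ℕ) (q q' n : Fin d → ℝ) : ℝ :=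
  ∑ k ∈ Finset.range ((s - s % 2) / 2 + 1),
    rcoef d s k * (tau q q' n) ^ (2 * k + s % 2) *
      (rho2 q n * rho2 q' n) ^ ((s - s % 2) / 2 - k)

/-- The linear functional `z ↦ ⟨z, v⟩` as a continuous linear map. -/
noncomputable def ipCLM {d : ℕ} (v : Fin d → ℝ) : (Fin d → ℝ) →L[ℝ] ℝ :=
  ∑ m, v m • ContinuousLinearMap.proj m

/-- `‖n‖² q − ⟨q, n⟩ n`, a multiple of the projection of `q` orthogonal to `n`. -/
noncomputable def orth {d : ℕ} (q n : Fin d → ℝ) : Fin d → ℝ :=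
  fun m => ip n n * q m - ip q n * n m

/-- The monomial `τ^a (ρ²)^b`. -/
noncomputable def mono {d : ℕ} (q' n : Fin d → ℝ) (a b : ℕ) (z : Fin d → ℝ) : ℝ :=
  tau z q' n ^ a * rho2 z n ^ b

lemma ip_comm {d : ℕ} (a b : Fin d → ℝ) : ip a b = ip b a := by
  simp only [ip, mul_comm]

lemma ipCLM_apply {d : ℕ} (v z : Fin d → ℝ) : ipCLM v z = ip z v := by
  simp [ipCLM, ip, mul_comm]

lemma ipCLM_single {d : ℕ} (v : Fin d → ℝ) (m : Fin d) : ipCLM v (Pi.single m 1) = v m := by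
  simp [ipCLM_apply, ip, Pi.single_apply]

lemma ip_orth {d : ℕ} (z q n : Fin d → ℝ) :
    ip z (orth q n) = ip n n * ip z q - ip q n * ip z n := by
  simp only [ip, orth, mul_sub, Finset.sum_sub_distrib, Finset.mul_sum]
  congr 1 <;> exact Finset.sum_congr rfl fun m _ => by ring

lemma ip_orth_self {d : ℕ} (q n : Fin d → ℝ) : ip n (orth q n) = 0 := by
  rw [ip_orth, ip_comm n q]
  ring

lemma ip_orth_orth {d : ℕ} (q q' n : Fin d → ℝ) :
    ip (orth q n) (orth q' n) = ip n n * tau q q' n := by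
  rw [ip_orth, ip_comm (orth q n) n, ip_orth_self, ip_comm _ q', ip_orth, tau,
    ip_comm q' q]
  ring

lemma tau_self {d : ℕ} (q n : Fin d → ℝ) : tau q q n = rho2 q n := by
  rw [tau, rho2]
  ring

lemma tau_comm {d : ℕ} (q q' n : Fin d → ℝ) : tau q q' n = tau q' q n := by
  rw [tau, tau, ip_comm q q']
  ring

lemma hasFDerivAt_ip {d : ℕ} (v y : Fin d → ℝ) :
    HasFDerivAt (fun z => ip z v) (ipCLM v) y := by
  simp only [← ipCLM_apply]
  exact (ipCLM v).hasFDerivAt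

lemma hasFDerivAt_ip_self {d : ℕ} (y : Fin d → ℝ) :
    HasFDerivAt (fun z => ip z z) ((2 : ℝ) • ipCLM y) y := by
  have h : ∀ m ∈ (Finset.univ : Finset (Fin d)),
      HasFDerivAt (fun z : Fin d → ℝ => z m * z m) (y m • ContinuousLinearMap.proj (R := ℝ)
        (φ := fun _ : Fin d => ℝ) m + y m • ContinuousLinearMap.proj m) y := fun m _ =>
    (hasFDerivAt_apply m y).mul (hasFDerivAt_apply m y)
  refine (HasFDerivAt.fun_sum h).congr_fderiv ?_
  ext z
  simp [ipCLM, Finset.mul_sum, two_mul, Finset.sum_add_distrib]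

lemma hasFDerivAt_tau {d : ℕ} (q' n y : Fin d → ℝ) :
    HasFDerivAt (fun z => tau z q' n) (ipCLM (orth q' n)) y := by
  have h : (fun z => tau z q' n) = fun z => ip z (orth q' n) := by
    funext z
    rw [ip_orth, tau]
    ring
  rw [h]
  exact hasFDerivAt_ip _ y

lemma hasFDerivAt_rho2 {d : ℕ} (n y : Fin d → ℝ) :
    HasFDerivAt (fun z => rho2 z n) ((2 : ℝ) • ipCLM (orth y n)) y := by
  refine (((hasFDerivAt_ip_self y).const_mul (ip n n)).sub
    ((hasFDerivAt_ip n y).pow 2)).congr_fderiv ?_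
  ext z
  simp [ipCLM_apply, ip_orth]
  ring

lemma hasFDerivAt_mono {d : ℕ} (q' n : Fin d → ℝ) (a b : ℕ) (y : Fin d → ℝ) :
    HasFDerivAt (mono q' n a b)
      ((a * mono q' n (a - 1) b y) • ipCLM (orth q' n) +
        (2 * b * mono q' n a (b - 1) y) • ipCLM (orth y n)) y := by
  refine (((hasFDerivAt_tau q' n y).pow a).mul
    ((hasFDerivAt_rho2 n y).pow b)).congr_fderiv ?_
  ext z
  simp [mono]
  ring

lemma hasFDerivAt_orth_apply {d : ℕ} (n y : Fin d → ℝ) (m : Fin d) :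
    HasFDerivAt (fun z => orth z n m)
      (ip n n • ContinuousLinearMap.proj m - n m • ipCLM n) y :=
  ((hasFDerivAt_apply m y).const_mul (ip n n)).sub ((hasFDerivAt_ip n y).mul_const (n m))

lemma fderiv_mono_single {d : ℕ} (q' n : Fin d → ℝ) (a b : ℕ) (y : Fin d → ℝ) (m : Fin d) :
    fderiv ℝ (mono q' n a b) y (Pi.single m 1) =
      a * orth q' n m * mono q' n (a - 1) b y +
        2 * b * (orth y n m * mono q' n a (b - 1) y) := by
  rw [(hasFDerivAt_mono q' n a b y).fderiv]
  simp [ipCLM_single]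
  ring

lemma hasFDerivAt_fderiv_mono {d : ℕ} (q' n : Fin d → ℝ) (a b : ℕ) (y : Fin d → ℝ)
    (m : Fin d) :
    HasFDerivAt (fun z => fderiv ℝ (mono q' n a b) z (Pi.single m 1))
      ((a * orth q' n m) • fderiv ℝ (mono q' n (a - 1) b) y +
        (2 * b : ℝ) • (orth y n m • fderiv ℝ (mono q' n a (b - 1)) y +
          mono q' n a (b - 1) y • (ip n n • ContinuousLinearMap.proj m - n m • ipCLM n))) y := by
  simp only [fderiv_mono_single]
  exact ((hasFDerivAt_mono q' n (a - 1) b y).differentiableAt.hasFDerivAt.const_mul _).add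
    (((hasFDerivAt_orth_apply n y m).mul
      (hasFDerivAt_mono q' n a (b - 1) y).differentiableAt.hasFDerivAt).const_mul _)

lemma sum_mul_fderiv_mono {d : ℕ} (q' n : Fin d → ℝ) (a b : ℕ) (y : Fin d → ℝ) :
    ∑ m, n m * fderiv ℝ (mono q' n a b) y (Pi.single m 1) = 0 := by
  have h₁ := ip_orth_self q' n
  have h₂ := ip_orth_self y n
  simp only [ip] at h₁ h₂
  calc ∑ m, n m * fderiv ℝ (mono q' n a b) y (Pi.single m 1)
      = (a * mono q' n (a - 1) b y) * ∑ m, n m * orth q' n m +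
        (2 * b * mono q' n a (b - 1) y) * ∑ m, n m * orth y n m := by
        rw [Finset.mul_sum, Finset.mul_sum, ← Finset.sum_add_distrib]
        exact Finset.sum_congr rfl fun m _ => by rw [fderiv_mono_single]; ring
    _ = 0 := by rw [h₁, h₂]; ring

lemma laplacian_mono {d : ℕ} (q' n : Fin d → ℝ) (a b : ℕ) (y : Fin d → ℝ) :
    ∑ m, fderiv ℝ (fun z => fderiv ℝ (mono q' n a b) z (Pi.single m 1)) y (Pi.single m 1) =
      ip n n * (a * (a - 1) * rho2 q' n * mono q' n (a - 2) b y +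
        b * (4 * a + 4 * (b - 1) + 2 * (d - 1)) * mono q' n a (b - 1) y) := by
  have hvv := ip_orth_orth q' q' n
  have hvw := ip_orth_orth y q' n
  have hww := ip_orth_orth y y n
  rw [tau_self] at hvv hww
  have hn : ∑ m, (ip n n - n m * n m) = ip n n * (d - 1) := by
    rw [Finset.sum_sub_distrib]
    simp [ip]
    ring
  calc _ = (a * (a - 1 : ℕ) * mono q' n (a - 2) b y) * ip (orth q' n) (orth q' n) +
        (4 * a * b * mono q' n (a - 1) (b - 1) y) * ip (orth y n) (orth q' n) +
        (4 * b * (b - 1 : ℕ) * mono q' n a (b - 2) y) * ip (orth y n) (orth y n) +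
        (2 * b * mono q' n a (b - 1) y) * ∑ m, (ip n n - n m * n m) := by
        rw [ip.eq_1 (orth q' n), ip.eq_1 (orth y n), ip.eq_1 (orth y n)]
        simp only [Finset.mul_sum, ← Finset.sum_add_distrib]
        refine Finset.sum_congr rfl fun m _ => ?_
        rw [(hasFDerivAt_fderiv_mono q' n a b y m).fderiv]
        simp [fderiv_mono_single, ipCLM_single, Nat.sub_sub]
        ring
    _ = _ := by
        rw [hvv, hvw, hww, hn]
        have ha : (a : ℝ) * (a - 1 : ℕ) = a * (a - 1) := by cases a <;> simp
        have hb : (b : ℝ) * (b - 1 : ℕ) * mono q' n a (b - 2) y * rho2 y n =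
            b * (b - 1) * mono q' n a (b - 1) y := by
          rcases b with _ | _ | b <;> simp [mono]
          ring
        have hab : (a : ℝ) * mono q' n (a - 1) (b - 1) y * tau y q' n =
            a * mono q' n a (b - 1) y := by
          cases a <;> simp [mono]
          ring
        linear_combination (mono q' n (a - 2) b y * ip n n * rho2 q' n) * ha +
          4 * ip n n * hb + 4 * b * ip n n * hab

lemma P_eq_sum_mono (d s : ℕ) (q' n : Fin d → ℝ) :
    (fun z => P d s z q' n) = fun z => ∑ k ∈ Finset.range (s / 2 + 1),
      (rcoef d s k * rho2 q' n ^ (s / 2 - k)) * mono q' n (2 * k + s % 2) (s / 2 - k) z := by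
  funext z
  have h : (s - s % 2) / 2 = s / 2 := by omega
  simp only [P, h]
  refine Finset.sum_congr rfl fun k _ => ?_
  rw [mono, mul_pow]
  ring

lemma P_comm (d s : ℕ) (q q' n : Fin d → ℝ) : P d s q q' n = P d s q' q n := by
  simp only [P, tau_comm q q', mul_comm (rho2 q n)]

lemma fderiv_P (d s : ℕ) (q' n y : Fin d → ℝ) :
    fderiv ℝ (fun z => P d s z q' n) y = ∑ k ∈ Finset.range (s / 2 + 1),
      (rcoef d s k * rho2 q' n ^ (s / 2 - k)) •
        fderiv ℝ (mono q' n (2 * k + s % 2) (s / 2 - k)) y := by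
  rw [P_eq_sum_mono]
  exact (HasFDerivAt.fun_sum fun k _ =>
    (hasFDerivAt_mono q' n _ _ y).differentiableAt.hasFDerivAt.const_mul _).fderiv

lemma rcoef_succ (d s k : ℕ) :
    rcoef d s (k + 1) *
        (((2 * (k + 1) + s % 2 : ℕ) : ℝ) * (((2 * (k + 1) + s % 2 : ℕ) : ℝ) - 1)) =
      -(rcoef d s k * ((s - (s % 2 : ℕ) - 2 * k) * (s + (s % 2 : ℕ) + d - 3 + 2 * k))) := by
  have hfac : (Nat.factorial (2 * (k + 1) + s % 2) : ℝ) =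
      ((2 * (k + 1) + s % 2 : ℕ) : ℝ) * (((2 * (k + 1) + s % 2 : ℕ) : ℝ) - 1) *
        Nat.factorial (2 * k + s % 2) := by
    rw [show 2 * (k + 1) + s % 2 = 2 * k + s % 2 + 1 + 1 by ring, Nat.factorial_succ,
      Nat.factorial_succ]
    push_cast
    ring
  have h₀ : (Nat.factorial (2 * k + s % 2) : ℝ) ≠ 0 := by positivity
  have h₁ : ((2 * (k + 1) + s % 2 : ℕ) : ℝ) ≠ 0 := by positivity
  have h₂ : ((2 * (k + 1) + s % 2 : ℕ) : ℝ) - 1 ≠ 0 := by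
    have : (1 : ℝ) < ((2 * (k + 1) + s % 2 : ℕ) : ℝ) := by exact_mod_cast (by omega)
    linarith
  rw [rcoef, rcoef, hfac, Finset.prod_range_succ, Finset.prod_range_succ, pow_succ]
  generalize ((2 * (k + 1) + s % 2 : ℕ) : ℝ) = c at h₁ h₂ ⊢
  field_simp
  ring

lemma laplacian_P (d s : ℕ) (q q' n : Fin d → ℝ) :
    ∑ m : Fin d, fderiv ℝ (fun y => fderiv ℝ (fun z => P d s z q' n) y (Pi.single m 1)) q
      (Pi.single m 1) = 0 := by
  have hterm : ∀ m : Fin d,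
      fderiv ℝ (fun y => fderiv ℝ (fun z => P d s z q' n) y (Pi.single m 1)) q
        (Pi.single m 1) = ∑ k ∈ Finset.range (s / 2 + 1),
      (rcoef d s k * rho2 q' n ^ (s / 2 - k)) * fderiv ℝ (fun y =>
        fderiv ℝ (mono q' n (2 * k + s % 2) (s / 2 - k)) y (Pi.single m 1)) q
          (Pi.single m 1) := by
    intro m
    simp only [fderiv_P, sum_apply, smul_apply,
      smul_eq_mul]
    rw [(HasFDerivAt.fun_sum fun k _ =>
      (hasFDerivAt_fderiv_mono q' n _ _ q m).differentiableAt.hasFDerivAt.const_mul _).fderiv]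
    simp
  simp only [hterm]
  rw [Finset.sum_comm]
  simp only [← Finset.mul_sum, laplacian_mono, mul_add (ip n n), mul_add (_ * _ ^ _),
    Finset.sum_add_distrib]
  rw [Finset.sum_range_succ', Finset.sum_range_succ _ (s / 2)]
  have hfirst : ((2 * 0 + s % 2 : ℕ) : ℝ) * (((2 * 0 + s % 2 : ℕ) : ℝ) - 1) = 0 := by
    rcases Nat.mod_two_eq_zero_or_one s with h | h <;> simp [h]
  rw [hfirst]
  simp only [Nat.sub_self, Nat.cast_zero, zero_mul, mul_zero, add_zero]
  rw [← Finset.sum_add_distrib]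
  refine Finset.sum_eq_zero fun k hk => ?_
  obtain ⟨b, hb⟩ : ∃ b, s / 2 = k + 1 + b := Nat.exists_eq_add_of_lt (Finset.mem_range.mp hk) |>.imp
    fun b h => by omega
  have hs : (s : ℝ) = 2 * (k + 1 + b) + (s % 2 : ℕ) := by exact_mod_cast (by omega)
  have hr := rcoef_succ d s k
  rw [show s / 2 - (k + 1) = b by omega, show s / 2 - k = b + 1 by omega,
    show 2 * (k + 1) + s % 2 - 2 = 2 * k + s % 2 by omega, Nat.add_sub_cancel]
  generalize mono q' n (2 * k + s % 2) b q = M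
  rw [hs] at hr
  push_cast at hr ⊢
  linear_combination (rho2 q' n ^ (b + 1) * ip n n * M) * hr

lemma sum_mul_fderiv_P (d s : ℕ) (q q' n : Fin d → ℝ) :
    ∑ m : Fin d, n m * fderiv ℝ (fun z => P d s z q' n) q (Pi.single m 1) = 0 := by
  simp only [fderiv_P, sum_apply, smul_apply,
    smul_eq_mul, Finset.mul_sum]
  rw [Finset.sum_comm]
  refine Finset.sum_eq_zero fun k _ => ?_
  simp only [mul_left_comm (n _), ← Finset.mul_sum, sum_mul_fderiv_mono, mul_zero]

/-- Gauge-invariance constraints for the undeformed spin-`s` generating polynomial. -/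
theorem gauge_invariance_constraints_undeformed
    (d s : ℕ) (hd : 3 ≤ d) (q q' n : Fin d → ℝ) :
    (∑ m : Fin d,
        fderiv ℝ (fun y => fderiv ℝ (fun z => P d s z q' n) y (Pi.single m 1)) q
          (Pi.single m 1)) = 0 ∧
    (∑ m : Fin d,
        fderiv ℝ (fun y => fderiv ℝ (fun z => P d s q z n) y (Pi.single m 1)) q'
          (Pi.single m 1)) = 0 ∧
    (∑ m : Fin d, n m * fderiv ℝ (fun z => P d s z q' n) q (Pi.single m 1)) = 0 ∧
    (∑ m : Fin d, n m * fderiv ℝ (fun z => P d s q z n) q' (Pi.single m 1)) = 0 := by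
  have hP : (fun z => P d s q z n) = fun z => P d s z q n := funext fun z => P_comm d s q z n
  simp only [hP]
  exact ⟨laplacian_P d s q q' n, laplacian_P d s q' q n, sum_mul_fderiv_P d s q q' n,
    sum_mul_fderiv_P d s q' q n⟩

end Stmt0
end

section
/- Gauge-invariance constraints for the deformed spin-s generating function (eqs. (baseq1), (baseq101)): with the notation of the context, let μ ∈ ℝ, set ν = s + (d−3)/2, and define V_ν : ℝ → ℝ by the everywhere absolutely convergent series V_ν(w) = Σ_{m=0}^∞ (−1)^m w^m / (4^m · m! · Γ(ν+m+1)), where Γ is the real Gamma function. Define, on the open set {(q,q',n) : n ≠ 0}, the function P_μ(q,q',n) = V_ν(μ²ρ²/‖n‖²) · V_ν(μ²ρ'²/‖n‖²) · Σ_{k=0}^{j} r_k · τ^{2k+ς} · (ρ²ρ'²)^{j−k}. Then on this set: (i) Σ_{m=1}^d ∂²P_μ/∂q^m∂q^m + μ² P_μ = 0; (ii) Σ_{m=1}^d ∂²P_μ/∂q'^m∂q'^m + μ² P_μ = 0; (iii) Σ_{m=1}^d n^m ∂P_μ/∂q^m = 0; and (iv) Σ_{m=1}^d n^m ∂P_μ/∂q'^m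 = 0. -/
namespace Stmt1

/-- the standard inner product on `ℝ^d` -/
noncomputable def ip {d : ℕ} (a b : Fin d → ℝ) : ℝ := ∑ m, a m * b m

/-- `ρ² = ‖n‖²‖q‖² − ⟨q,n⟩²` -/
noncomputable def rho2 {d : ℕ} (q n : Fin d → ℝ) : ℝ := ip n n * ip q q - (ip q n) ^ 2

/-- `τ = ‖n‖²⟨q,q'⟩ − ⟨q,n⟩⟨q',n⟩` -/
noncomputable def tau {d : ℕ} (q q' n : Fin d → ℝ) : ℝ :=
  ip n n * ip q q' - ip q n * ip q' n

/-- the coefficients `r_k` -/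
noncomputable def rcoef (d s k : ℕ) : ℝ :=
  ((-1 : ℝ) ^ k / (Nat.factorial (2 * k + s % 2) : ℝ)) *
    (∏ i ∈ Finset.range k, ((s : ℝ) - ((s % 2 : ℕ) : ℝ) - 2 * (i : ℝ))) *
    (∏ i ∈ Finset.range k, ((s : ℝ) + ((s % 2 : ℕ) : ℝ) + (d : ℝ) - 5 + 2 * ((i : ℝ) + 1)))

/-- the Bessel-type entire function
`V_ν(w) = Σ_{m=0}^∞ (−1)^m w^m / (4^m · m! · Γ(ν+m+1))`. -/
noncomputable def V (ν : ℝ) (w : ℝ) : ℝ :=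
  ∑' m : ℕ, (-1 : ℝ) ^ m * w ^ m /
    ((4 : ℝ) ^ m * (Nat.factorial m : ℝ) * Real.Gamma (ν + (m : ℝ) + 1))

/-- the index `ν = s + (d−3)/2` -/
noncomputable def nu (d s : ℕ) : ℝ := (s : ℝ) + ((d : ℝ) - 3) / 2

/-- the deformed spin-`s` generating function
`P_μ(q,q',n) = V_ν(μ²ρ²/‖n‖²) · V_ν(μ²ρ'²/‖n‖²) · Σ_{k=0}^{j} r_k τ^{2k+ς} (ρ²ρ'²)^{j−k}`. -/
noncomputable def Pmu (d s : ℕ) (μ : ℝ) (q q' n : Fin d → ℝ) : ℝ :=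
  V (nu d s) (μ ^ 2 * rho2 q n / ip n n) * V (nu d s) (μ ^ 2 * rho2 q' n / ip n n) *
    ∑ k ∈ Finset.range ((s - s % 2) / 2 + 1),
      rcoef d s k * (tau q q' n) ^ (2 * k + s % 2) *
        (rho2 q n * rho2 q' n) ^ ((s - s % 2) / 2 - k)

/-- The `m`-th term of the series defining `V ν w`. -/
noncomputable def Vterm (ν w : ℝ) (m : ℕ) : ℝ :=
  (-1 : ℝ) ^ m * w ^ m / ((4 : ℝ) ^ m * (Nat.factorial m : ℝ) * Real.Gamma (ν + (m : ℝ) + 1))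

lemma Gamma_le_Gamma_add_nat {ν : ℝ} (hν : 0 ≤ ν) (m : ℕ) :
    Real.Gamma (ν + 1) ≤ Real.Gamma (ν + m + 1) := by
  induction m with
  | zero => simp
  | succ k ih =>
    have hpos : 0 < ν + k + 1 := by positivity
    have hG := Real.Gamma_pos_of_pos hpos
    have hrec : Real.Gamma (ν + ((k + 1 : ℕ) : ℝ) + 1) = (ν + k + 1) * Real.Gamma (ν + k + 1) := by
      rw [← Real.Gamma_add_one hpos.ne']
      push_cast
      ring_nf
    rw [hrec]
    have hk : (0 : ℝ) ≤ k := Nat.cast_nonneg k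
    nlinarith

lemma abs_Vterm_le {ν : ℝ} (hν : 0 ≤ ν) (w : ℝ) (m : ℕ) :
    |Vterm ν w m| ≤ |w| ^ m / (Nat.factorial m : ℝ) * (Real.Gamma (ν + 1))⁻¹ := by
  have h1 : 0 < Real.Gamma (ν + 1) := Real.Gamma_pos_of_pos (by positivity)
  have h2 := Gamma_le_Gamma_add_nat hν m
  have h3 : 0 < Real.Gamma (ν + m + 1) := h1.trans_le h2
  have h4 : (0 : ℝ) < Nat.factorial m := by positivity
  have h5 : (1 : ℝ) ≤ 4 ^ m := one_le_pow₀ (by norm_num)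
  rw [Vterm, abs_div, abs_mul, abs_pow, abs_pow, abs_neg, abs_one, one_pow, one_mul,
    abs_of_pos (by positivity : (0 : ℝ) < 4 ^ m * (Nat.factorial m : ℝ) * Real.Gamma (ν + m + 1)),
    ← div_eq_mul_inv, div_div]
  gcongr
  nlinarith

lemma summable_Vterm {ν : ℝ} (hν : 0 ≤ ν) (w : ℝ) : Summable (Vterm ν w) :=
  Summable.of_norm_bounded ((Real.summable_pow_div_factorial |w|).mul_right _)
    (abs_Vterm_le hν w)

lemma Vterm_succ_deriv (ν w : ℝ) (m : ℕ) :
    (-1 : ℝ) ^ (m + 1) * (((m + 1 : ℕ) : ℝ) * w ^ m) /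
      ((4 : ℝ) ^ (m + 1) * (Nat.factorial (m + 1) : ℝ) * Real.Gamma (ν + ((m + 1 : ℕ) : ℝ) + 1)) =
    -1 / 4 * Vterm (ν + 1) w m := by
  have hm : ((m : ℝ) + 1) ≠ 0 := by positivity
  have hG : ν + ((m + 1 : ℕ) : ℝ) + 1 = ν + 1 + m + 1 := by push_cast; ring
  rw [Vterm, hG, Nat.factorial_succ, pow_succ, pow_succ]
  push_cast
  rw [mul_div_assoc', ← mul_div_mul_left (-1 / 4 * ((-1 : ℝ) ^ m * w ^ m)) _
    (by positivity : (4 * ((m : ℝ) + 1)) ≠ 0)]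
  congr 1 <;> ring

/-- Differentiation raises the index of `V`. -/
lemma hasDerivAt_V {ν : ℝ} (hν : 0 ≤ ν) (w : ℝ) :
    HasDerivAt (V ν) (-1 / 4 * V (ν + 1) w) w := by
  set D : ℕ → ℝ → ℝ := fun m y => (-1 : ℝ) ^ m * ((m : ℝ) * y ^ (m - 1)) /
    ((4 : ℝ) ^ m * (Nat.factorial m : ℝ) * Real.Gamma (ν + (m : ℝ) + 1)) with hD
  have hν1 : 0 ≤ ν + 1 := by positivity
  have hDsucc : ∀ m y, D (m + 1) y = -1 / 4 * Vterm (ν + 1) y m := fun m y =>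
    Vterm_succ_deriv ν y m
  have hD0 : ∀ y, D 0 y = 0 := fun y => by simp [hD]
  set R : ℝ := |w| + 1 with hR
  have hG : 0 < Real.Gamma (ν + 1 + 1) := Real.Gamma_pos_of_pos (by positivity)
  set u : ℕ → ℝ := fun m => R ^ (m - 1) / (Nat.factorial (m - 1) : ℝ) *
    (Real.Gamma (ν + 1 + 1))⁻¹ with hu
  have hsum : Summable u :=
    (summable_nat_add_iff 1).1 ((Real.summable_pow_div_factorial R).mul_right _)
  have hmain : HasDerivAt (fun y => ∑' m, Vterm ν y m) (∑' m, D m w) w := by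
    refine hasDerivAt_tsum_of_isPreconnected (t := Metric.ball 0 R) (y₀ := 0) hsum
      Metric.isOpen_ball (convex_ball _ _).isPreconnected ?_ ?_ ?_ (summable_Vterm hν 0) ?_
    · intro m y _
      exact ((hasDerivAt_pow m y).const_mul _).div_const _
    · intro m y hy
      have hy' : |y| ≤ R := by
        have := Metric.mem_ball.1 hy
        rw [dist_zero_right, Real.norm_eq_abs] at this
        exact this.le
      cases m with
      | zero => rw [hD0, norm_zero]; positivity
      | succ k =>
        rw [hDsucc, norm_mul, Real.norm_eq_abs, Real.norm_eq_abs]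
        have h1 := abs_Vterm_le hν1 y k
        have h2 : |y| ^ k / (Nat.factorial k : ℝ) * (Real.Gamma (ν + 1 + 1))⁻¹ ≤ u (k + 1) := by
          simp only [hu, Nat.add_sub_cancel]
          gcongr
        have h3 : |(-1 / 4 : ℝ)| = 1 / 4 := by norm_num [abs_of_neg]
        rw [h3]
        have h4 := abs_nonneg (Vterm (ν + 1) y k)
        linarith
    · exact Metric.mem_ball_self (by positivity)
    · rw [Metric.mem_ball, dist_zero_right, Real.norm_eq_abs]
      linarith
  have hval : ∑' m, D m w = -1 / 4 * V (ν + 1) w := by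
    have hs : Summable fun m => D m w := by
      refine (summable_nat_add_iff 1).1 ?_
      simp only [hDsucc]
      exact (summable_Vterm hν1 w).mul_left _
    rw [hs.tsum_eq_zero_add, hD0, zero_add]
    simp only [hDsucc]
    rw [tsum_mul_left]
    rfl
  rw [← hval]
  exact hmain

/-- The Bessel recurrence, in terms of `V`. -/
lemma V_recurrence {ν : ℝ} (hν : 0 ≤ ν) (w : ℝ) :
    w * V (ν + 2) w - 4 * (ν + 1) * V (ν + 1) w + 4 * V ν w = 0 := by
  have s0 := summable_Vterm hν w
  have s1 := summable_Vterm (by positivity : 0 ≤ ν + 1) w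
  have s2 := summable_Vterm (by positivity : 0 ≤ ν + 2) w
  have e0 : V ν w = Vterm ν w 0 + ∑' m, Vterm ν w (m + 1) := s0.tsum_eq_zero_add
  have e1 : V (ν + 1) w = Vterm (ν + 1) w 0 + ∑' m, Vterm (ν + 1) w (m + 1) :=
    s1.tsum_eq_zero_add
  have e2 : V (ν + 2) w = ∑' m, Vterm (ν + 2) w m := rfl
  have hzero : (ν + 1) * Vterm (ν + 1) w 0 = Vterm ν w 0 := by
    have hν1 : ν + 1 ≠ 0 := by positivity
    have hG := (Real.Gamma_pos_of_pos (by positivity : 0 < ν + 1)).ne'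
    simp only [Vterm, Nat.cast_zero, add_zero, pow_zero, Nat.factorial_zero, Nat.cast_one]
    rw [Real.Gamma_add_one hν1]
    field_simp
  have hterm : ∀ m, w * Vterm (ν + 2) w m =
      4 * (ν + 1) * Vterm (ν + 1) w (m + 1) - 4 * Vterm ν w (m + 1) := by
    intro m
    have hp : (0 : ℝ) < ν + m + 2 := by positivity
    have hG := (Real.Gamma_pos_of_pos hp).ne'
    have g2 : Real.Gamma (ν + 2 + m + 1) = (ν + m + 2) * Real.Gamma (ν + m + 2) := by
      rw [← Real.Gamma_add_one hp.ne']; ring_nf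
    have g1 : Real.Gamma (ν + 1 + ((m + 1 : ℕ) : ℝ) + 1) =
        (ν + m + 2) * Real.Gamma (ν + m + 2) := by
      rw [← Real.Gamma_add_one hp.ne']; push_cast; ring_nf
    have g0 : Real.Gamma (ν + ((m + 1 : ℕ) : ℝ) + 1) = Real.Gamma (ν + m + 2) := by
      push_cast; ring_nf
    have hm : (m : ℝ) + 1 ≠ 0 := by positivity
    have hf : (Nat.factorial m : ℝ) ≠ 0 := by positivity
    simp only [Vterm]
    rw [g2, g1, g0, Nat.factorial_succ]
    push_cast
    have hp' := hp.ne'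
    field_simp
    ring
  have hsum : w * ∑' m, Vterm (ν + 2) w m =
      4 * (ν + 1) * ∑' m, Vterm (ν + 1) w (m + 1) - 4 * ∑' m, Vterm ν w (m + 1) := by
    rw [← tsum_mul_left, ← tsum_mul_left, ← tsum_mul_left, ← Summable.tsum_sub]
    · exact tsum_congr hterm
    · exact ((summable_nat_add_iff 1).2 s1).mul_left _
    · exact ((summable_nat_add_iff 1).2 s0).mul_left _
  rw [e0, e1, e2]
  linear_combination hsum - 4 * hzero

/-- The linear functional `z ↦ ⟨z, a⟩`. -/
noncomputable def ipCLM {d : ℕ} (a : Fin d → ℝ) : (Fin d → ℝ) →L[ℝ] ℝ :=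
  ∑ m, a m • ContinuousLinearMap.proj m

lemma ipCLM_apply {d : ℕ} (a z : Fin d → ℝ) : ipCLM a z = ip z a := by
  simp [ipCLM, ip, mul_comm]

lemma sum_mul_eq_ip {d : ℕ} (a b : Fin d → ℝ) : ∑ m, a m * b m = ip a b := rfl

lemma ip_comm {d : ℕ} (a b : Fin d → ℝ) : ip a b = ip b a := by
  simp only [ip, mul_comm]

lemma ipCLM_single {d : ℕ} (a : Fin d → ℝ) (m : Fin d) : ipCLM a (Pi.single m 1) = a m := by
  simp [ipCLM_apply, ip, Pi.single_apply]

lemma hasFDerivAt_ip {d : ℕ} (a z : Fin d → ℝ) : HasFDerivAt (fun z => ip z a) (ipCLM a) z := by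
  have h : (fun z => ip z a) = ipCLM a := funext fun z => (ipCLM_apply a z).symm
  rw [h]
  exact (ipCLM a).hasFDerivAt

lemma hasFDerivAt_ip_self {d : ℕ} (z : Fin d → ℝ) :
    HasFDerivAt (fun z => ip z z) ((2 : ℝ) • ipCLM z) z := by
  have h : HasFDerivAt (fun z : Fin d → ℝ => ∑ m, z m * z m)
      (∑ m, (z m • ContinuousLinearMap.proj (R := ℝ) (φ := fun _ : Fin d => ℝ) m
        + z m • ContinuousLinearMap.proj (R := ℝ) (φ := fun _ : Fin d => ℝ) m)) z :=
    HasFDerivAt.fun_sum fun m _ => (hasFDerivAt_apply m z).mul (hasFDerivAt_apply m z)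
  refine h.congr_fderiv ?_
  rw [ipCLM, Finset.smul_sum]
  exact Finset.sum_congr rfl fun m _ => (two_smul ℝ _).symm

/-- The derivative of `z ↦ rho2 z n`. -/
noncomputable def rhoCLM {d : ℕ} (z n : Fin d → ℝ) : (Fin d → ℝ) →L[ℝ] ℝ :=
  (2 * ip n n) • ipCLM z - (2 * ip z n) • ipCLM n

/-- The derivative of `z ↦ tau z q' n`. -/
noncomputable def tauCLM {d : ℕ} (q' n : Fin d → ℝ) : (Fin d → ℝ) →L[ℝ] ℝ :=
  ip n n • ipCLM q' - ip q' n • ipCLM n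

lemma hasFDerivAt_rho2 {d : ℕ} (n z : Fin d → ℝ) :
    HasFDerivAt (fun z => rho2 z n) (rhoCLM z n) z := by
  refine (((hasFDerivAt_ip_self z).const_mul (ip n n)).sub
    ((hasFDerivAt_ip n z).pow 2)).congr_fderiv ?_
  ext v
  simp [rhoCLM]
  ring

lemma hasFDerivAt_tau {d : ℕ} (q' n z : Fin d → ℝ) :
    HasFDerivAt (fun z => tau z q' n) (tauCLM q' n) z :=
  ((hasFDerivAt_ip q' z).const_mul (ip n n)).sub ((hasFDerivAt_ip n z).mul_const (ip q' n))

lemma rhoCLM_single {d : ℕ} (z n : Fin d → ℝ) (m : Fin d) :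
    rhoCLM z n (Pi.single m 1) = 2 * ip n n * z m - 2 * ip z n * n m := by
  simp [rhoCLM, ipCLM_single]

lemma tauCLM_single {d : ℕ} (q' n : Fin d → ℝ) (m : Fin d) :
    tauCLM q' n (Pi.single m 1) = ip n n * q' m - ip q' n * n m := by
  simp [tauCLM, ipCLM_single]

lemma hasFDerivAt_rhoCLM_single {d : ℕ} (n z : Fin d → ℝ) (m : Fin d) :
    HasFDerivAt (fun z => rhoCLM z n (Pi.single m 1))
      ((2 * ip n n) • ContinuousLinearMap.proj m - (2 * n m) • ipCLM n) z := by
  simp only [rhoCLM_single]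
  refine (((hasFDerivAt_apply m z).const_mul (2 * ip n n)).sub
    (((hasFDerivAt_ip n z).const_mul 2).mul_const (n m))).congr_fderiv ?_
  ext v
  simp
  ring

/-- Chain rule for a separated function of `rho2` and `tau`. -/
lemma hasFDerivAt_rho2_mul_tau {d : ℕ} {g h : ℝ → ℝ} {g' h' : ℝ} {q' n z : Fin d → ℝ}
    (hg : HasDerivAt g g' (rho2 z n)) (hh : HasDerivAt h h' (tau z q' n)) :
    HasFDerivAt (fun z => g (rho2 z n) * h (tau z q' n))
      ((g' * h (tau z q' n)) • rhoCLM z n + (g (rho2 z n) * h') • tauCLM q' n) z := by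
  refine ((hg.comp_hasFDerivAt z (hasFDerivAt_rho2 n z)).mul
    (hh.comp_hasFDerivAt z (hasFDerivAt_tau q' n z))).congr_fderiv ?_
  ext v
  simp
  ring

lemma sum_rhoCLM_sq {d : ℕ} (q n : Fin d → ℝ) :
    ∑ m, rhoCLM q n (Pi.single m 1) ^ 2 = 4 * ip n n * rho2 q n := by
  have : ∀ m, rhoCLM q n (Pi.single m 1) ^ 2 = 4 * ip n n ^ 2 * (q m * q m)
      - 8 * ip n n * ip q n * (q m * n m) + 4 * ip q n ^ 2 * (n m * n m) := fun m => by
    rw [rhoCLM_single]; ring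
  simp only [this, Finset.sum_add_distrib, Finset.sum_sub_distrib, ← Finset.mul_sum]
  simp only [sum_mul_eq_ip, rho2]
  ring

lemma sum_rhoCLM_mul_tauCLM {d : ℕ} (q q' n : Fin d → ℝ) :
    ∑ m, rhoCLM q n (Pi.single m 1) * tauCLM q' n (Pi.single m 1) =
      2 * ip n n * tau q q' n := by
  have : ∀ m, rhoCLM q n (Pi.single m 1) * tauCLM q' n (Pi.single m 1) =
      2 * ip n n ^ 2 * (q m * q' m) - 2 * ip n n * ip q' n * (q m * n m)
      - 2 * ip n n * ip q n * (q' m * n m) + 2 * ip q n * ip q' n * (n m * n m) := fun m => by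
    rw [rhoCLM_single, tauCLM_single]; ring
  simp only [this, Finset.sum_add_distrib, Finset.sum_sub_distrib, ← Finset.mul_sum]
  simp only [sum_mul_eq_ip, tau]
  ring

lemma sum_tauCLM_sq {d : ℕ} (q' n : Fin d → ℝ) :
    ∑ m, tauCLM q' n (Pi.single m 1) ^ 2 = ip n n * rho2 q' n := by
  have : ∀ m, tauCLM q' n (Pi.single m 1) ^ 2 = ip n n ^ 2 * (q' m * q' m)
      - 2 * ip n n * ip q' n * (q' m * n m) + ip q' n ^ 2 * (n m * n m) := fun m => by
    rw [tauCLM_single]; ring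
  simp only [this, Finset.sum_add_distrib, Finset.sum_sub_distrib, ← Finset.mul_sum]
  simp only [sum_mul_eq_ip, rho2]
  ring

lemma sum_laplacian_rho2 {d : ℕ} (n : Fin d → ℝ) :
    ∑ m, (2 * ip n n - 2 * n m * n m) = 2 * ip n n * ((d : ℝ) - 1) := by
  have : ∀ m, (2 * ip n n - 2 * n m * n m) = 2 * ip n n - 2 * (n m * n m) := fun m => by ring
  simp only [this, Finset.sum_sub_distrib, ← Finset.mul_sum]
  simp only [sum_mul_eq_ip, Finset.sum_const, Finset.card_univ, Fintype.card_fin, nsmul_eq_mul]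
  ring

lemma sum_mul_rhoCLM {d : ℕ} (q n : Fin d → ℝ) :
    ∑ m, n m * rhoCLM q n (Pi.single m 1) = 0 := by
  have : ∀ m, n m * rhoCLM q n (Pi.single m 1) = 2 * ip n n * (q m * n m)
      - 2 * ip q n * (n m * n m) := fun m => by
    rw [rhoCLM_single]; ring
  simp only [this, Finset.sum_sub_distrib, ← Finset.mul_sum]
  simp only [sum_mul_eq_ip]
  ring

lemma sum_mul_tauCLM {d : ℕ} (q' n : Fin d → ℝ) :
    ∑ m, n m * tauCLM q' n (Pi.single m 1) = 0 := by
  have : ∀ m, n m * tauCLM q' n (Pi.single m 1) = ip n n * (q' m * n m)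
      - ip q' n * (n m * n m) := fun m => by
    rw [tauCLM_single]; ring
  simp only [this, Finset.sum_sub_distrib, ← Finset.mul_sum]
  simp only [sum_mul_eq_ip]
  ring

section Separated

variable {d : ℕ} {ι : Type*} (K : Finset ι) {g g' g'' h h' h'' : ι → ℝ → ℝ}

lemma hasFDerivAt_sum_separated
    (hg : ∀ k x, HasDerivAt (g k) (g' k x) x) (hh : ∀ k x, HasDerivAt (h k) (h' k x) x)
    (q q' n : Fin d → ℝ) :
    HasFDerivAt (fun z => ∑ k ∈ K, g k (rho2 z n) * h k (tau z q' n))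
      (∑ k ∈ K, ((g' k (rho2 q n) * h k (tau q q' n)) • rhoCLM q n +
        (g k (rho2 q n) * h' k (tau q q' n)) • tauCLM q' n)) q :=
  HasFDerivAt.fun_sum fun k _ => hasFDerivAt_rho2_mul_tau (hg k _) (hh k _)

lemma gradient_sum_separated
    (hg : ∀ k x, HasDerivAt (g k) (g' k x) x) (hh : ∀ k x, HasDerivAt (h k) (h' k x) x)
    (q q' n : Fin d → ℝ) :
    ∑ m, n m * fderiv ℝ (fun z => ∑ k ∈ K, g k (rho2 z n) * h k (tau z q' n)) q
      (Pi.single m 1) = 0 := by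
  rw [(hasFDerivAt_sum_separated K hg hh q q' n).fderiv, Finset.sum_add_distrib,
    ← Finset.sum_smul, ← Finset.sum_smul]
  simp only [add_apply, smul_apply, smul_eq_mul, mul_add,
    mul_left_comm (n _), Finset.sum_add_distrib, ← Finset.mul_sum]
  rw [sum_mul_rhoCLM, sum_mul_tauCLM]
  ring

lemma laplacian_sum_separated
    (hg : ∀ k x, HasDerivAt (g k) (g' k x) x) (hg' : ∀ k x, HasDerivAt (g' k) (g'' k x) x)
    (hh : ∀ k x, HasDerivAt (h k) (h' k x) x) (hh' : ∀ k x, HasDerivAt (h' k) (h'' k x) x)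
    (q q' n : Fin d → ℝ) :
    ∑ m, fderiv ℝ (fun y => fderiv ℝ
        (fun z => ∑ k ∈ K, g k (rho2 z n) * h k (tau z q' n)) y (Pi.single m 1)) q
        (Pi.single m 1) =
      ip n n * ∑ k ∈ K, (4 * rho2 q n * g'' k (rho2 q n) * h k (tau q q' n)
        + 4 * tau q q' n * g' k (rho2 q n) * h' k (tau q q' n)
        + 2 * ((d : ℝ) - 1) * g' k (rho2 q n) * h k (tau q q' n)
        + rho2 q' n * g k (rho2 q n) * h'' k (tau q q' n)) := by
  have hsecond : ∀ m : Fin d, fderiv ℝ (fun y => fderiv ℝ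
        (fun z => ∑ k ∈ K, g k (rho2 z n) * h k (tau z q' n)) y (Pi.single m 1)) q
        (Pi.single m 1) =
      ∑ k ∈ K, (g'' k (rho2 q n) * h k (tau q q' n) * rhoCLM q n (Pi.single m 1) ^ 2
        + 2 * g' k (rho2 q n) * h' k (tau q q' n) *
          (rhoCLM q n (Pi.single m 1) * tauCLM q' n (Pi.single m 1))
        + g' k (rho2 q n) * h k (tau q q' n) * (2 * ip n n - 2 * n m * n m)
        + g k (rho2 q n) * h'' k (tau q q' n) * tauCLM q' n (Pi.single m 1) ^ 2) := by
    intro m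
    have hfirst : (fun y => fderiv ℝ
        (fun z => ∑ k ∈ K, g k (rho2 z n) * h k (tau z q' n)) y (Pi.single m 1)) =
        fun y => ∑ k ∈ K, (g' k (rho2 y n) * h k (tau y q' n) * rhoCLM y n (Pi.single m 1) +
          g k (rho2 y n) * h' k (tau y q' n) * tauCLM q' n (Pi.single m 1)) := by
      funext y
      rw [(hasFDerivAt_sum_separated K hg hh y q' n).fderiv]
      simp
    rw [hfirst, (HasFDerivAt.fun_sum fun k _ =>
      ((hasFDerivAt_rho2_mul_tau (q' := q') (hg' k (rho2 q n)) (hh k _)).fun_mul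
        (hasFDerivAt_rhoCLM_single n q m)).fun_add
      ((hasFDerivAt_rho2_mul_tau (q' := q') (hg k (rho2 q n)) (hh' k _)).mul_const
        (tauCLM q' n (Pi.single m 1)))).fderiv, sum_apply]
    refine Finset.sum_congr rfl fun k _ => ?_
    simp [ipCLM_single]
    ring
  simp only [hsecond]
  rw [Finset.sum_comm, Finset.mul_sum]
  refine Finset.sum_congr rfl fun k _ => ?_
  simp only [Finset.sum_add_distrib, ← Finset.mul_sum]
  rw [sum_rhoCLM_sq, sum_rhoCLM_mul_tauCLM, sum_tauCLM_sq, sum_laplacian_rho2]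
  ring

end Separated

lemma rcoef_succ (d s k : ℕ) :
    ((2 * k + s % 2 : ℕ) + 1 : ℝ) * ((2 * k + s % 2 : ℕ) + 2 : ℝ) * rcoef d s (k + 1) =
      -(((s : ℝ) - ((s % 2 : ℕ) : ℝ) - 2 * k) *
        ((s : ℝ) + ((s % 2 : ℕ) : ℝ) + d - 5 + 2 * ((k : ℝ) + 1))) * rcoef d s k := by
  have hf : (Nat.factorial (2 * (k + 1) + s % 2) : ℝ) =
      ((2 * k + s % 2 : ℕ) + 2 : ℝ) * (((2 * k + s % 2 : ℕ) + 1 : ℝ) *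
        Nat.factorial (2 * k + s % 2)) := by
    rw [show 2 * (k + 1) + s % 2 = 2 * k + s % 2 + 1 + 1 by ring, Nat.factorial_succ,
      Nat.factorial_succ]
    push_cast
    ring
  have h0 : (Nat.factorial (2 * k + s % 2) : ℝ) ≠ 0 := by positivity
  have h1 : ((2 * k + s % 2 : ℕ) + 1 : ℝ) ≠ 0 := by positivity
  have h2 : ((2 * k + s % 2 : ℕ) + 2 : ℝ) ≠ 0 := by positivity
  rw [rcoef, rcoef, hf, Finset.prod_range_succ, Finset.prod_range_succ, pow_succ]
  generalize ((2 * k + s % 2 : ℕ) : ℝ) = a at h1 h2 ⊢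
  field_simp

/-- The radial profile `x ↦ V ν (c x) x ^ b` of a term of `Pmu`. -/
noncomputable def profile (ν c : ℝ) (b : ℕ) (x : ℝ) : ℝ := V ν (c * x) * x ^ b

/-- The derivative of `profile`. -/
noncomputable def profileDeriv (ν c : ℝ) (b : ℕ) (x : ℝ) : ℝ :=
  c * (-1 / 4) * (V (ν + 1) (c * x) * x ^ b) + b * (V ν (c * x) * x ^ (b - 1))

/-- The second derivative of `profile`. -/
noncomputable def profileDeriv₂ (ν c : ℝ) (b : ℕ) (x : ℝ) : ℝ :=
  c ^ 2 / 16 * (V (ν + 2) (c * x) * x ^ b) + 2 * (c * (-1 / 4)) * b *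
    (V (ν + 1) (c * x) * x ^ (b - 1)) +
    b * (b - 1 : ℕ) * (V ν (c * x) * x ^ (b - 1 - 1))

lemma hasDerivAt_profile {ν : ℝ} (hν : 0 ≤ ν) (c : ℝ) (b : ℕ) (x : ℝ) :
    HasDerivAt (profile ν c b) (profileDeriv ν c b x) x := by
  have hV : HasDerivAt (fun x => V ν (c * x)) (-1 / 4 * V (ν + 1) (c * x) * (c * 1)) x :=
    (hasDerivAt_V hν (c * x)).comp x ((hasDerivAt_id x).const_mul c)
  refine (hV.mul (hasDerivAt_pow b x)).congr_deriv ?_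
  rw [profileDeriv]
  ring

lemma hasDerivAt_profileDeriv {ν : ℝ} (hν : 0 ≤ ν) (c : ℝ) (b : ℕ) (x : ℝ) :
    HasDerivAt (profileDeriv ν c b) (profileDeriv₂ ν c b x) x := by
  have h1 := hasDerivAt_profile (by positivity : 0 ≤ ν + 1) c b x
  have h0 := hasDerivAt_profile hν c (b - 1) x
  refine ((h1.const_mul (c * (-1 / 4))).add (h0.const_mul (b : ℝ))).congr_deriv ?_
  rw [profileDeriv, profileDeriv, profileDeriv₂, show ν + 1 + 1 = ν + 2 by ring]
  ring

lemma mul_natCast_mul_pow_pred (x : ℝ) (b : ℕ) : x * (b * x ^ (b - 1)) = b * x ^ b := by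
  cases b with
  | zero => simp
  | succ b => simp only [Nat.add_sub_cancel, pow_succ]; ring

lemma natCast_mul_natCast_pred (b : ℕ) : (b : ℝ) * ((b - 1 : ℕ) : ℝ) = b * (b - 1) := by
  cases b with
  | zero => simp
  | succ b => simp

/-- Up to the factor `V ν (c x)`, the radial operator acts on the terms of `Pmu` by
differences of these quantities, so that the sum telescopes. -/
noncomputable def telescope (d s : ℕ) (x y t : ℝ) (k : ℕ) : ℝ :=
  rcoef d s k * ((2 * k + s % 2 : ℕ) * (2 * k + s % 2 - 1 : ℕ) * t ^ (2 * k + s % 2 - 1 - 1)) *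
    x ^ ((s - s % 2) / 2 - k) * y ^ ((s - s % 2) / 2 - k + 1)

lemma telescope_zero (d s : ℕ) (x y t : ℝ) : telescope d s x y t 0 = 0 := by
  rcases Nat.mod_two_eq_zero_or_one s with h | h <;> simp [telescope, h]

lemma natCast_eq_two_mul_half_add (s : ℕ) :
    (s : ℝ) = 2 * ((s - s % 2) / 2 : ℕ) + (s % 2 : ℕ) := by
  have : s = 2 * ((s - s % 2) / 2) + s % 2 := by omega
  exact_mod_cast this

lemma telescope_last (d s : ℕ) (x y t : ℝ) :
    telescope d s x y t ((s - s % 2) / 2 + 1) = 0 := by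
  have h := rcoef_succ d s ((s - s % 2) / 2)
  have hs := natCast_eq_two_mul_half_add s
  have hz : (s : ℝ) - ((s % 2 : ℕ) : ℝ) - 2 * ((s - s % 2) / 2 : ℕ) = 0 := by linarith
  rw [hz, zero_mul, neg_zero, zero_mul] at h
  have hr : rcoef d s ((s - s % 2) / 2 + 1) = 0 :=
    (mul_eq_zero.1 h).resolve_left (by positivity)
  rw [telescope, hr]
  ring

lemma radial_operator_term (d s : ℕ) (hν : 0 ≤ nu d s) (c x y t : ℝ) {k : ℕ}
    (hk : k ≤ (s - s % 2) / 2) :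
    rcoef d s k * y ^ ((s - s % 2) / 2 - k) *
      (4 * x * profileDeriv₂ (nu d s) c ((s - s % 2) / 2 - k) x * t ^ (2 * k + s % 2)
      + 4 * t * profileDeriv (nu d s) c ((s - s % 2) / 2 - k) x *
        ((2 * k + s % 2 : ℕ) * t ^ (2 * k + s % 2 - 1))
      + 2 * ((d : ℝ) - 1) * profileDeriv (nu d s) c ((s - s % 2) / 2 - k) x * t ^ (2 * k + s % 2)
      + y * profile (nu d s) c ((s - s % 2) / 2 - k) x *
        ((2 * k + s % 2 : ℕ) * ((2 * k + s % 2 - 1 : ℕ) * t ^ (2 * k + s % 2 - 1 - 1)))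
      + c * profile (nu d s) c ((s - s % 2) / 2 - k) x * t ^ (2 * k + s % 2)) =
    V (nu d s) (c * x) * (telescope d s x y t k - telescope d s x y t (k + 1)) := by
  have hs := natCast_eq_two_mul_half_add s
  have hr := rcoef_succ d s k
  have hode := V_recurrence hν (c * x)
  have hnu : nu d s = s + ((d : ℝ) - 3) / 2 := rfl
  have hb : (((s - s % 2) / 2 - k : ℕ) : ℝ) = ((s - s % 2) / 2 : ℕ) - k := Nat.cast_sub hk
  have ha : ((2 * k + s % 2 : ℕ) : ℝ) = 2 * k + (s % 2 : ℕ) := by push_cast; ring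
  have e1 : 2 * (k + 1) + s % 2 = 2 * k + s % 2 + 2 := by ring
  have e2 : (s - s % 2) / 2 - (k + 1) = (s - s % 2) / 2 - k - 1 := by omega
  have e3 : 2 * k + s % 2 + 2 - 1 = 2 * k + s % 2 + 1 := by omega
  rw [telescope, telescope, e1, e2, e3, Nat.add_sub_cancel, profile, profileDeriv, profileDeriv₂]
  generalize (s - s % 2) / 2 - k = b at *
  generalize 2 * k + s % 2 = a at *
  generalize V (nu d s + 2) (c * x) = V2 at *
  generalize V (nu d s + 1) (c * x) = V1 at *
  generalize V (nu d s) (c * x) = V0 at *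
  generalize rcoef d s (k + 1) = r1 at *
  generalize rcoef d s k = r at *
  have hx := mul_natCast_mul_pow_pred x b
  have hxx := mul_natCast_mul_pow_pred x (b - 1)
  have hbb := natCast_mul_natCast_pred b
  have ht := mul_natCast_mul_pow_pred t a
  have hy : (b : ℝ) * y ^ (b - 1 + 1) = b * y ^ b := by
    rw [pow_succ]
    linear_combination mul_natCast_mul_pow_pred y b
  have hr' : ((a : ℝ) + 1) * (a + 2) * r1 = -(b * (4 * (b - 1) + 4 * a + 2 * (d - 1))) * r := by
    rw [hr, hb, ha, hs]
    ring
  have hs' : 2 * (b : ℝ) + a = s := by rw [hb, ha, hs]; ring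
  have hode' : 4 * (c * x) * (V2 / 16) + (4 * s + 2 * d - 2) * (-1 / 4 * V1) + V0 = 0 := by
    rw [hnu] at hode
    linear_combination hode / 4
  push_cast
  generalize x ^ (b - 1 - 1) = X2 at *
  generalize x ^ (b - 1) = X1 at *
  generalize x ^ b = X0 at *
  generalize y ^ (b - 1 + 1) = Y1 at *
  rw [pow_succ y b]
  generalize y ^ b = Y0 at *
  generalize t ^ (a - 1 - 1) = t2 at *
  generalize t ^ (a - 1) = t1 at *
  generalize t ^ a = t0 at *
  generalize ((b - 1 : ℕ) : ℝ) = b1 at *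
  linear_combination (r * Y0) * (-2 * c * V1 * t0 * hx + 4 * b * V0 * t0 * hxx
      + 4 * V0 * X1 * t0 * hbb + 4 * (-1 / 4 * c * V1 * X0 + V0 * b * X1) * ht
      + c * X0 * t0 * hode' - c * V1 * X0 * t0 * hs')
    + V0 * t0 * X1 * Y1 * hr' - V0 * t0 * X1 * r * (4 * (b - 1) + 4 * a + 2 * (d - 1)) * hy

lemma nu_nonneg {d : ℕ} (hd : 3 ≤ d) (s : ℕ) : 0 ≤ nu d s := by
  have : (3 : ℝ) ≤ d := by exact_mod_cast hd
  have : (0 : ℝ) ≤ s := Nat.cast_nonneg s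
  rw [nu]
  linarith

lemma Pmu_comm (d s : ℕ) (μ : ℝ) (q q' n : Fin d → ℝ) :
    Pmu d s μ q q' n = Pmu d s μ q' q n := by
  have ht : tau q q' n = tau q' q n := by rw [tau, tau, ip_comm q q']; ring
  rw [Pmu, Pmu, ht, mul_comm (V _ _) (V _ _), mul_comm (rho2 q n)]

lemma Pmu_eq_sum_separated (d s : ℕ) (μ : ℝ) (q q' n : Fin d → ℝ) :
    Pmu d s μ q q' n = ∑ k ∈ Finset.range ((s - s % 2) / 2 + 1),
      V (nu d s) (μ ^ 2 * rho2 q' n / ip n n) *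
        (rcoef d s k * rho2 q' n ^ ((s - s % 2) / 2 - k)) *
        profile (nu d s) (μ ^ 2 / ip n n) ((s - s % 2) / 2 - k) (rho2 q n) *
        tau q q' n ^ (2 * k + s % 2) := by
  rw [Pmu, Finset.mul_sum]
  refine Finset.sum_congr rfl fun k _ => ?_
  rw [profile, mul_pow, div_mul_eq_mul_div]
  ring

lemma ip_self_ne_zero {d : ℕ} {n : Fin d → ℝ} (hn : n ≠ 0) : ip n n ≠ 0 := by
  intro h
  apply hn
  funext m
  have := (Finset.sum_eq_zero_iff_of_nonneg fun i _ => mul_self_nonneg (n i)).1 h m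
    (Finset.mem_univ m)
  exact mul_self_eq_zero.1 this

lemma gradient_Pmu {d : ℕ} (s : ℕ) (hd : 3 ≤ d) (μ : ℝ) (q q' n : Fin d → ℝ) :
    ∑ m : Fin d, n m * fderiv ℝ (fun z => Pmu d s μ z q' n) q (Pi.single m 1) = 0 := by
  simp only [Pmu_eq_sum_separated]
  exact gradient_sum_separated (Finset.range ((s - s % 2) / 2 + 1))
    (fun k x => (hasDerivAt_profile (nu_nonneg hd s) (μ ^ 2 / ip n n)
      ((s - s % 2) / 2 - k) x).const_mul _)
    (fun k x => hasDerivAt_pow (2 * k + s % 2) x) q q' n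

lemma laplacian_Pmu {d : ℕ} (s : ℕ) (hd : 3 ≤ d) (μ : ℝ) (q q' : Fin d → ℝ) {n : Fin d → ℝ}
    (hn : n ≠ 0) :
    (∑ m : Fin d,
        fderiv ℝ (fun y => fderiv ℝ (fun z => Pmu d s μ z q' n) y (Pi.single m 1)) q
          (Pi.single m 1)) + μ ^ 2 * Pmu d s μ q q' n = 0 := by
  simp only [Pmu_eq_sum_separated]
  have hlap := laplacian_sum_separated (Finset.range ((s - s % 2) / 2 + 1))
    (fun k x => (hasDerivAt_profile (nu_nonneg hd s) (μ ^ 2 / ip n n)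
      ((s - s % 2) / 2 - k) x).const_mul
        (V (nu d s) (μ ^ 2 * rho2 q' n / ip n n) *
          (rcoef d s k * rho2 q' n ^ ((s - s % 2) / 2 - k))))
    (fun k x => (hasDerivAt_profileDeriv (nu_nonneg hd s) (μ ^ 2 / ip n n)
      ((s - s % 2) / 2 - k) x).const_mul _)
    (fun k x => hasDerivAt_pow (2 * k + s % 2) x)
    (fun k x => (hasDerivAt_pow (2 * k + s % 2 - 1) x).const_mul _) q q' n
  rw [hlap]
  have hμ : μ ^ 2 = ip n n * (μ ^ 2 / ip n n) := (mul_div_cancel₀ _ (ip_self_ne_zero hn)).symm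
  generalize V (nu d s) (μ ^ 2 * rho2 q' n / ip n n) = A
  generalize μ ^ 2 / ip n n = c at *
  rw [hμ, mul_assoc, ← mul_add, Finset.mul_sum, ← Finset.sum_add_distrib]
  have hterm : ∀ k ∈ Finset.range ((s - s % 2) / 2 + 1), _ = A * V (nu d s) (c * rho2 q n) *
      (telescope d s (rho2 q n) (rho2 q' n) (tau q q' n) k -
        telescope d s (rho2 q n) (rho2 q' n) (tau q q' n) (k + 1)) := fun k hk => by
    rw [mul_assoc, ← radial_operator_term d s (nu_nonneg hd s) c (rho2 q n) (rho2 q' n)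
      (tau q q' n) (Finset.mem_range_succ_iff.1 hk)]
  rw [Finset.sum_congr rfl fun k hk => Eq.trans ?_ (hterm k hk), ← Finset.mul_sum,
    Finset.sum_range_sub', telescope_zero, telescope_last]
  · ring
  · ring

/-- Gauge-invariance constraints for the deformed spin-`s` generating function. -/
theorem gauge_invariance_constraints_deformed
    (d s : ℕ) (hd : 3 ≤ d) (μ : ℝ) (q q' n : Fin d → ℝ) (hn : n ≠ 0) :
    (∀ w : ℝ, Summable (fun m : ℕ => (-1 : ℝ) ^ m * w ^ m /
        ((4 : ℝ) ^ m * (Nat.factorial m : ℝ) * Real.Gamma (nu d s + (m : ℝ) + 1)))) ∧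
    (∑ m : Fin d,
        fderiv ℝ (fun y => fderiv ℝ (fun z => Pmu d s μ z q' n) y (Pi.single m 1)) q
          (Pi.single m 1)) + μ ^ 2 * Pmu d s μ q q' n = 0 ∧
    (∑ m : Fin d,
        fderiv ℝ (fun y => fderiv ℝ (fun z => Pmu d s μ q z n) y (Pi.single m 1)) q'
          (Pi.single m 1)) + μ ^ 2 * Pmu d s μ q q' n = 0 ∧
    (∑ m : Fin d, n m * fderiv ℝ (fun z => Pmu d s μ z q' n) q (Pi.single m 1)) = 0 ∧
    (∑ m : Fin d, n m * fderiv ℝ (fun z => Pmu d s μ q z n) q' (Pi.single m 1)) = 0 := by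
  refine ⟨summable_Vterm (nu_nonneg hd s), laplacian_Pmu s hd μ q q' hn, ?_,
    gradient_Pmu s hd μ q q' n, ?_⟩
  · simp only [Pmu_comm d s μ q]
    exact laplacian_Pmu s hd μ q' q hn
  · simp only [Pmu_comm d s μ q]
    exact gradient_Pmu s hd μ q' q n

end Stmt1
end

section
/- Commutation relations of the covariance algebra (eq. (lie00)): let ε₁, a₁, ε₂, a₂, H : ℝ^d × ℝ^d → ℝ be C² functions. Then δ_{(ε₁,a₁)}(δ_{(ε₂,a₂)} H) − δ_{(ε₂,a₂)}(δ_{(ε₁,a₁)} H) = δ_{(ε₃,a₃)} H, where ε₃ = {ε₁, ε₂} and a₃ = {ε₁, a₂} − {ε₂, a₁}. -/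
namespace Stmt5

/-- partial derivative of a phase-space function in the `m`-th coordinate direction -/
noncomputable def pdX {d : ℕ} (f : (Fin d → ℝ) × (Fin d → ℝ) → ℝ) (m : Fin d)
    (z : (Fin d → ℝ) × (Fin d → ℝ)) : ℝ :=
  fderiv ℝ f z (Pi.single m 1, 0)

/-- partial derivative of a phase-space function in the `m`-th momentum direction -/
noncomputable def pdP {d : ℕ} (f : (Fin d → ℝ) × (Fin d → ℝ) → ℝ) (m : Fin d)
    (z : (Fin d → ℝ) × (Fin d → ℝ)) : ℝ :=
  fderiv ℝ f z (0, Pi.single m 1)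

/-- the Poisson bracket `{f,g} = Σ_m (∂f/∂x^m ∂g/∂p_m − ∂f/∂p_m ∂g/∂x^m)` -/
noncomputable def poisson {d : ℕ} (f g : (Fin d → ℝ) × (Fin d → ℝ) → ℝ)
    (z : (Fin d → ℝ) × (Fin d → ℝ)) : ℝ :=
  ∑ m : Fin d, (pdX f m z * pdP g m z - pdP f m z * pdX g m z)

/-- the covariance (gauge) variation `δ_{(ε,a)} H = 2 a H + {ε, H}` -/
noncomputable def gvar {d : ℕ} (ε a H : (Fin d → ℝ) × (Fin d → ℝ) → ℝ) :
    (Fin d → ℝ) × (Fin d → ℝ) → ℝ :=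
  fun z => 2 * a z * H z + poisson ε H z

section PoissonBracket

variable {d : ℕ} {f g h : (Fin d → ℝ) × (Fin d → ℝ) → ℝ}

theorem hasFDerivAt_fderiv_apply (hf : ContDiff ℝ 2 f) (v z : (Fin d → ℝ) × (Fin d → ℝ)) :
    HasFDerivAt (fun w => fderiv ℝ f w v) ((fderiv ℝ (fderiv ℝ f) z).flip v) z := by
  have hd : DifferentiableAt ℝ (fderiv ℝ f) z :=
    ((hf.fderiv_right (m := 1) (by norm_num)).differentiable (by norm_num)) z
  simpa using hd.hasFDerivAt.clm_apply (hasFDerivAt_const v z)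

theorem fderiv_fderiv_comm (hf : ContDiff ℝ 2 f) (z v w : (Fin d → ℝ) × (Fin d → ℝ)) :
    fderiv ℝ (fderiv ℝ f) z v w = fderiv ℝ (fderiv ℝ f) z w v :=
  (hf.contDiffAt.isSymmSndFDerivAt (by simp)).eq v w

theorem hasFDerivAt_poisson (hf : ContDiff ℝ 2 f) (hg : ContDiff ℝ 2 g)
    (z : (Fin d → ℝ) × (Fin d → ℝ)) :
    HasFDerivAt (poisson f g)
      (∑ m : Fin d,
        ((pdX f m z • (fderiv ℝ (fderiv ℝ g) z).flip (0, Pi.single m 1) +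
            pdP g m z • (fderiv ℝ (fderiv ℝ f) z).flip (Pi.single m 1, 0)) -
          (pdP f m z • (fderiv ℝ (fderiv ℝ g) z).flip (Pi.single m 1, 0) +
            pdX g m z • (fderiv ℝ (fderiv ℝ f) z).flip (0, Pi.single m 1)))) z :=
  HasFDerivAt.fun_sum fun _ _ =>
    ((hasFDerivAt_fderiv_apply hf _ z).mul (hasFDerivAt_fderiv_apply hg _ z)).sub
      ((hasFDerivAt_fderiv_apply hf _ z).mul (hasFDerivAt_fderiv_apply hg _ z))

theorem fderiv_poisson_apply (hf : ContDiff ℝ 2 f) (hg : ContDiff ℝ 2 g)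
    (z v : (Fin d → ℝ) × (Fin d → ℝ)) :
    fderiv ℝ (poisson f g) z v =
      ∑ m : Fin d,
        ((pdX f m z * fderiv ℝ (fderiv ℝ g) z v (0, Pi.single m 1) +
            pdP g m z * fderiv ℝ (fderiv ℝ f) z v (Pi.single m 1, 0)) -
          (pdP f m z * fderiv ℝ (fderiv ℝ g) z v (Pi.single m 1, 0) +
            pdX g m z * fderiv ℝ (fderiv ℝ f) z v (0, Pi.single m 1))) := by
  simp [(hasFDerivAt_poisson hf hg z).fderiv]

theorem sum_sum_eq_zero_of_antisymm {ι : Type*} [Fintype ι] (T : ι → ι → ℝ)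
    (hT : ∀ m n, T m n + T n m = 0) : ∑ m, ∑ n, T m n = 0 := by
  have hswap : ∑ m, ∑ n, T m n = ∑ m, ∑ n, T n m := Finset.sum_comm
  have hadd : ∑ m, ∑ n, T m n + ∑ m, ∑ n, T n m = 0 := by
    simp only [← Finset.sum_add_distrib, hT, Finset.sum_const_zero]
  linarith

/-- The Jacobi identity for the Poisson bracket, in derivation form. -/
theorem poisson_jacobi (hf : ContDiff ℝ 2 f) (hg : ContDiff ℝ 2 g) (hh : ContDiff ℝ 2 h)
    (z : (Fin d → ℝ) × (Fin d → ℝ)) :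
    poisson f (poisson g h) z - poisson g (poisson f h) z = poisson (poisson f g) h z := by
  rw [← sub_eq_zero]
  simp only [poisson.eq_1 f (poisson g h), poisson.eq_1 g (poisson f h),
    poisson.eq_1 (poisson f g) h, pdX.eq_1 (poisson _ _), pdP.eq_1 (poisson _ _),
    fderiv_poisson_apply hf hg, fderiv_poisson_apply hf hh, fderiv_poisson_apply hg hh,
    Finset.mul_sum, Finset.sum_mul, ← Finset.sum_sub_distrib]
  refine sum_sum_eq_zero_of_antisymm _ fun m n => ?_
  have hPX : ∀ {k : (Fin d → ℝ) × (Fin d → ℝ) → ℝ}, ContDiff ℝ 2 k → ∀ i j : Fin d,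
      fderiv ℝ (fderiv ℝ k) z (0, Pi.single i 1) (Pi.single j 1, 0) =
        fderiv ℝ (fderiv ℝ k) z (Pi.single j 1, 0) (0, Pi.single i 1) :=
    fun hk _ _ => fderiv_fderiv_comm hk z _ _
  have hXX : ∀ {k : (Fin d → ℝ) × (Fin d → ℝ) → ℝ}, ContDiff ℝ 2 k →
      fderiv ℝ (fderiv ℝ k) z (Pi.single n 1, 0) (Pi.single m 1, 0) =
        fderiv ℝ (fderiv ℝ k) z (Pi.single m 1, 0) (Pi.single n 1, 0) :=
    fun hk => fderiv_fderiv_comm hk z _ _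
  have hPP : ∀ {k : (Fin d → ℝ) × (Fin d → ℝ) → ℝ}, ContDiff ℝ 2 k →
      fderiv ℝ (fderiv ℝ k) z (0, Pi.single n 1) (0, Pi.single m 1) =
        fderiv ℝ (fderiv ℝ k) z (0, Pi.single m 1) (0, Pi.single n 1) :=
    fun hk => fderiv_fderiv_comm hk z _ _
  simp only [hPX hf, hPX hg, hPX hh, hXX hf, hXX hg, hXX hh, hPP hf, hPP hg, hPP hh]
  ring

theorem poisson_add_right {z : (Fin d → ℝ) × (Fin d → ℝ)} (hg : DifferentiableAt ℝ g z)
    (hh : DifferentiableAt ℝ h z) :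
    poisson f (fun w => g w + h w) z = poisson f g z + poisson f h z := by
  simp only [poisson, pdX, pdP, fderiv_fun_add hg hh, add_apply,
    ← Finset.sum_add_distrib]
  exact Finset.sum_congr rfl fun _ _ => by ring

theorem poisson_mul_right {z : (Fin d → ℝ) × (Fin d → ℝ)} (hg : DifferentiableAt ℝ g z)
    (hh : DifferentiableAt ℝ h z) :
    poisson f (fun w => g w * h w) z = g z * poisson f h z + h z * poisson f g z := by
  simp only [poisson, pdX, pdP, fderiv_fun_mul hg hh, add_apply,
    smul_apply, smul_eq_mul, Finset.mul_sum, ← Finset.sum_add_distrib]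
  exact Finset.sum_congr rfl fun _ _ => by ring

theorem poisson_const_mul_right {z : (Fin d → ℝ) × (Fin d → ℝ)} (c : ℝ)
    (hg : DifferentiableAt ℝ g z) :
    poisson f (fun w => c * g w) z = c * poisson f g z := by
  simp only [poisson, pdX, pdP, fderiv_const_mul hg, smul_apply,
    smul_eq_mul, Finset.mul_sum]
  exact Finset.sum_congr rfl fun _ _ => by ring

theorem poisson_gvar_right {ε a H : (Fin d → ℝ) × (Fin d → ℝ) → ℝ} (hε : ContDiff ℝ 2 ε)
    (ha : ContDiff ℝ 2 a) (hH : ContDiff ℝ 2 H) (z : (Fin d → ℝ) × (Fin d → ℝ)) :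
    poisson f (gvar ε a H) z =
      2 * a z * poisson f H z + 2 * H z * poisson f a z + poisson f (poisson ε H) z := by
  have ha' : DifferentiableAt ℝ a z := ha.differentiable (by norm_num) z
  have hH' : DifferentiableAt ℝ H z := hH.differentiable (by norm_num) z
  unfold gvar
  rw [poisson_add_right ((ha'.const_mul 2).fun_mul hH')
    (hasFDerivAt_poisson hε hH z).differentiableAt,
    poisson_mul_right (ha'.const_mul 2) hH', poisson_const_mul_right 2 ha']
  ring

end PoissonBracket

/-- Commutation relations of the covariance algebra:
`[δ_{(ε₁,a₁)}, δ_{(ε₂,a₂)}] H = δ_{(ε₃,a₃)} H` with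
`ε₃ = {ε₁,ε₂}` and `a₃ = {ε₁,a₂} − {ε₂,a₁}`. -/
theorem covariance_algebra_commutator
    (d : ℕ) (ε₁ a₁ ε₂ a₂ H : (Fin d → ℝ) × (Fin d → ℝ) → ℝ)
    (hε₁ : ContDiff ℝ 2 ε₁) (ha₁ : ContDiff ℝ 2 a₁)
    (hε₂ : ContDiff ℝ 2 ε₂) (ha₂ : ContDiff ℝ 2 a₂)
    (hH : ContDiff ℝ 2 H) (z : (Fin d → ℝ) × (Fin d → ℝ)) :
    gvar ε₁ a₁ (gvar ε₂ a₂ H) z - gvar ε₂ a₂ (gvar ε₁ a₁ H) z =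
      gvar (fun w => poisson ε₁ ε₂ w)
        (fun w => poisson ε₁ a₂ w - poisson ε₂ a₁ w) H z := by
  have hJ := poisson_jacobi hε₁ hε₂ hH z
  rw [gvar.eq_1 ε₁ a₁ (gvar _ _ _), gvar.eq_1 ε₂ a₂ (gvar _ _ _),
    poisson_gvar_right hε₂ ha₂ hH, poisson_gvar_right hε₁ ha₁ hH]
  simp only [gvar]
  linear_combination hJ

end Stmt5
end

section
/- Closure of classical global symmetries under the covariance bracket (eq. (glob000) and Sec. 9.2.4): let H, ε₁, a₁, ε₂, a₂ : ℝ^d × ℝ^d → ℝ be C² functions such that 2 a₁ H + {ε₁, H} = 0 and 2 a₂ H + {ε₂, H} = 0 identically. Then the pair ε₃ = {ε₁, ε₂}, a₃ = {ε₁, a₂} − {ε₂, a₁} also satisfies 2 a₃ H + {ε₃, H} = 0 identically. -/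
namespace Stmt6

/-- partial derivative of a phase-space function in the `m`-th coordinate direction -/
noncomputable def pdX {d : ℕ} (f : (Fin d → ℝ) × (Fin d → ℝ) → ℝ) (m : Fin d)
    (z : (Fin d → ℝ) × (Fin d → ℝ)) : ℝ :=
  fderiv ℝ f z (Pi.single m 1, 0)

/-- partial derivative of a phase-space function in the `m`-th momentum direction -/
noncomputable def pdP {d : ℕ} (f : (Fin d → ℝ) × (Fin d → ℝ) → ℝ) (m : Fin d)
    (z : (Fin d → ℝ) × (Fin d → ℝ)) : ℝ :=
  fderiv ℝ f z (0, Pi.single m 1)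

/-- the Poisson bracket `{f,g} = Σ_m (∂f/∂x^m ∂g/∂p_m − ∂f/∂p_m ∂g/∂x^m)` -/
noncomputable def poisson {d : ℕ} (f g : (Fin d → ℝ) × (Fin d → ℝ) → ℝ)
    (z : (Fin d → ℝ) × (Fin d → ℝ)) : ℝ :=
  ∑ m : Fin d, (pdX f m z * pdP g m z - pdP f m z * pdX g m z)

/-- The Hamiltonian vector field of `f`, normalized so that `{f,g} = dg (X_f)`. -/
noncomputable def hamiltonianField {d : ℕ} (f : (Fin d → ℝ) × (Fin d → ℝ) → ℝ)
    (z : (Fin d → ℝ) × (Fin d → ℝ)) : (Fin d → ℝ) × (Fin d → ℝ) :=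
  ∑ m : Fin d, (pdX f m z • ((0, Pi.single m 1) : (Fin d → ℝ) × (Fin d → ℝ)) -
    pdP f m z • ((Pi.single m 1, 0) : (Fin d → ℝ) × (Fin d → ℝ)))

section Poisson

variable {d : ℕ} {f g h : (Fin d → ℝ) × (Fin d → ℝ) → ℝ}

theorem clm_hamiltonianField (f : (Fin d → ℝ) × (Fin d → ℝ) → ℝ) (z : (Fin d → ℝ) × (Fin d → ℝ))
    (L : (Fin d → ℝ) × (Fin d → ℝ) →L[ℝ] ℝ) :
    L (hamiltonianField f z) =
      ∑ m : Fin d, (pdX f m z * L (0, Pi.single m 1) - pdP f m z * L (Pi.single m 1, 0)) := by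
  simp only [hamiltonianField, map_sum, map_sub, map_smul, smul_eq_mul]

theorem poisson_eq_fderiv_hamiltonianField (f g : (Fin d → ℝ) × (Fin d → ℝ) → ℝ)
    (z : (Fin d → ℝ) × (Fin d → ℝ)) :
    poisson f g z = fderiv ℝ g z (hamiltonianField f z) :=
  (clm_hamiltonianField f z (fderiv ℝ g z)).symm

theorem poisson_antisymm (f g : (Fin d → ℝ) × (Fin d → ℝ) → ℝ) (z : (Fin d → ℝ) × (Fin d → ℝ)) :
    poisson f g z = -poisson g f z := by
  simp only [poisson, ← Finset.sum_neg_distrib]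
  exact Finset.sum_congr rfl fun m _ => by ring

theorem differentiable_fderiv_of_contDiff_two (hf : ContDiff ℝ 2 f) :
    Differentiable ℝ (fderiv ℝ f) :=
  (hf.fderiv_right (m := 1) (by norm_num)).differentiable one_ne_zero

theorem fderiv_poisson_apply (hf : ContDiff ℝ 2 f) (hg : ContDiff ℝ 2 g)
    (z v : (Fin d → ℝ) × (Fin d → ℝ)) :
    fderiv ℝ (poisson f g) z v =
      fderiv ℝ (fderiv ℝ g) z v (hamiltonianField f z) -
        fderiv ℝ (fderiv ℝ f) z v (hamiltonianField g z) := by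
  have hasFDerivAt_partial : ∀ {k : (Fin d → ℝ) × (Fin d → ℝ) → ℝ}, ContDiff ℝ 2 k →
      ∀ u, HasFDerivAt (fun w => fderiv ℝ k w u) ((fderiv ℝ (fderiv ℝ k) z).flip u) z :=
    fun hk u => by
      simpa using (differentiable_fderiv_of_contDiff_two hk z).hasFDerivAt.clm_apply
        (hasFDerivAt_const u z)
  have key := HasFDerivAt.fun_sum (u := Finset.univ) fun (m : Fin d) _ =>
    ((hasFDerivAt_partial hf (Pi.single m 1, 0)).mul
      (hasFDerivAt_partial hg (0, Pi.single m 1))).sub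
      ((hasFDerivAt_partial hf (0, Pi.single m 1)).mul
        (hasFDerivAt_partial hg (Pi.single m 1, 0)))
  have hpoisson := HasFDerivAt.fderiv (f := poisson f g) key
  rw [hpoisson, clm_hamiltonianField, clm_hamiltonianField, ← Finset.sum_sub_distrib,
    sum_apply]
  refine Finset.sum_congr rfl fun m _ => ?_
  simp only [pdX, pdP, sub_apply, add_apply,
    smul_apply, ContinuousLinearMap.flip_apply, smul_eq_mul]
  ring

theorem poisson_jacobi (hf : ContDiff ℝ 2 f) (hg : ContDiff ℝ 2 g) (hh : ContDiff ℝ 2 h)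
    (z : (Fin d → ℝ) × (Fin d → ℝ)) :
    poisson (poisson f g) h z = poisson f (poisson g h) z - poisson g (poisson f h) z := by
  have symm : ∀ {k : (Fin d → ℝ) × (Fin d → ℝ) → ℝ}, ContDiff ℝ 2 k →
      IsSymmSndFDerivAt ℝ k z := fun hk => hk.contDiffAt.isSymmSndFDerivAt (by simp)
  rw [poisson_antisymm (poisson f g) h]
  simp only [poisson_eq_fderiv_hamiltonianField _ (poisson _ _), fderiv_poisson_apply hf hg,
    fderiv_poisson_apply hg hh, fderiv_poisson_apply hf hh]
  rw [(symm hf).eq (hamiltonianField h z), (symm hg).eq (hamiltonianField h z),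
    (symm hh).eq (hamiltonianField f z)]
  ring

theorem poisson_mul_right {z : (Fin d → ℝ) × (Fin d → ℝ)} (f : (Fin d → ℝ) × (Fin d → ℝ) → ℝ)
    (hg : DifferentiableAt ℝ g z) (hh : DifferentiableAt ℝ h z) :
    poisson f (fun w => g w * h w) z = g z * poisson f h z + h z * poisson f g z := by
  simp only [poisson_eq_fderiv_hamiltonianField, fderiv_fun_mul hg hh,
    add_apply, smul_apply, smul_eq_mul]

theorem poisson_const_mul_right {z : (Fin d → ℝ) × (Fin d → ℝ)}
    (f : (Fin d → ℝ) × (Fin d → ℝ) → ℝ) (hg : DifferentiableAt ℝ g z) (c : ℝ) :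
    poisson f (fun w => c * g w) z = c * poisson f g z := by
  simp only [poisson_eq_fderiv_hamiltonianField, fderiv_const_mul hg,
    smul_apply, smul_eq_mul]

end Poisson

/-- Closure of classical global symmetries under the covariance bracket:
if `2a₁H + {ε₁,H} = 0` and `2a₂H + {ε₂,H} = 0`, then the pair
`ε₃ = {ε₁,ε₂}`, `a₃ = {ε₁,a₂} − {ε₂,a₁}` satisfies `2a₃H + {ε₃,H} = 0`. -/
theorem global_symmetries_closed
    (d : ℕ) (H ε₁ a₁ ε₂ a₂ : (Fin d → ℝ) × (Fin d → ℝ) → ℝ)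
    (hH : ContDiff ℝ 2 H)
    (hε₁ : ContDiff ℝ 2 ε₁) (ha₁ : ContDiff ℝ 2 a₁)
    (hε₂ : ContDiff ℝ 2 ε₂) (ha₂ : ContDiff ℝ 2 a₂)
    (hsym₁ : ∀ z, 2 * a₁ z * H z + poisson ε₁ H z = 0)
    (hsym₂ : ∀ z, 2 * a₂ z * H z + poisson ε₂ H z = 0) :
    ∀ z, 2 * (poisson ε₁ a₂ z - poisson ε₂ a₁ z) * H z +
      poisson (fun w => poisson ε₁ ε₂ w) H z = 0 := by
  intro z
  have dH : Differentiable ℝ H := hH.differentiable two_ne_zero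
  have poisson_symmetry : ∀ {ε a : (Fin d → ℝ) × (Fin d → ℝ) → ℝ}, ContDiff ℝ 2 a →
      (∀ w, 2 * a w * H w + poisson ε H w = 0) → ∀ η : (Fin d → ℝ) × (Fin d → ℝ) → ℝ,
      poisson η (poisson ε H) z = -2 * (a z * poisson η H z + H z * poisson η a z) := by
    intro ε a ha hsym η
    have da : Differentiable ℝ a := ha.differentiable two_ne_zero
    have hbracket : poisson ε H = fun w => -2 * (a w * H w) :=
      funext fun w => by linarith [hsym w]
    rw [hbracket, poisson_const_mul_right η ((da z).fun_mul (dH z)),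
      poisson_mul_right η (da z) (dH z)]
  change _ + poisson (poisson ε₁ ε₂) H z = 0
  rw [poisson_jacobi hε₁ hε₂ hH, poisson_symmetry ha₂ hsym₂, poisson_symmetry ha₁ hsym₁]
  linear_combination -2 * a₂ z * hsym₁ z + 2 * a₁ z * hsym₂ z

end Stmt6
end

section
/- Classical trivial symmetries form an ideal (eq. (trivcl)): let H, μ : ℝ^d × ℝ^d → ℝ be C² functions. Then: (i) the pair (ε_t, a_t) = (μH, −(1/2){μ, H}) is a global symmetry of H, i.e. 2 a_t H + {ε_t, H} = 0; (ii) if (ε, a) is any global symmetry of H, then the bracket pair ε₃ = {ε, μH}, a₃ = {ε, −(1/2){μ,H}} − {μH, a} is again of trivial form: ε₃ = μ' H and a₃ = −(1/2){μ', H}, where μ' = {ε, μ} − 2 μ a. -/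
namespace Stmt7

/-- partial derivative of a phase-space function in the `m`-th coordinate direction -/
noncomputable def pdX {d : ℕ} (f : (Fin d → ℝ) × (Fin d → ℝ) → ℝ) (m : Fin d)
    (z : (Fin d → ℝ) × (Fin d → ℝ)) : ℝ :=
  fderiv ℝ f z (Pi.single m 1, 0)

/-- partial derivative of a phase-space function in the `m`-th momentum direction -/
noncomputable def pdP {d : ℕ} (f : (Fin d → ℝ) × (Fin d → ℝ) → ℝ) (m : Fin d)
    (z : (Fin d → ℝ) × (Fin d → ℝ)) : ℝ :=
  fderiv ℝ f z (0, Pi.single m 1)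

/-- the Poisson bracket `{f,g} = Σ_m (∂f/∂x^m ∂g/∂p_m − ∂f/∂p_m ∂g/∂x^m)` -/
noncomputable def poisson {d : ℕ} (f g : (Fin d → ℝ) × (Fin d → ℝ) → ℝ)
    (z : (Fin d → ℝ) × (Fin d → ℝ)) : ℝ :=
  ∑ m : Fin d, (pdX f m z * pdP g m z - pdP f m z * pdX g m z)

section Bracket

variable {d : ℕ} {f g h : (Fin d → ℝ) × (Fin d → ℝ) → ℝ} {z : (Fin d → ℝ) × (Fin d → ℝ)}

/-- The Hamiltonian vector field of `g`, so that `{f, g}` is the derivative of `f` along it. -/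
noncomputable def hamiltonianField (g : (Fin d → ℝ) × (Fin d → ℝ) → ℝ)
    (z : (Fin d → ℝ) × (Fin d → ℝ)) : (Fin d → ℝ) × (Fin d → ℝ) :=
  ∑ m : Fin d, (pdP g m z • ((Pi.single m 1, 0) : (Fin d → ℝ) × (Fin d → ℝ)) -
    pdX g m z • ((0, Pi.single m 1) : (Fin d → ℝ) × (Fin d → ℝ)))

theorem map_hamiltonianField (L : (Fin d → ℝ) × (Fin d → ℝ) →L[ℝ] ℝ) :
    L (hamiltonianField g z) =
      ∑ m : Fin d, (L (Pi.single m 1, 0) * pdP g m z - L (0, Pi.single m 1) * pdX g m z) := by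
  simp only [hamiltonianField, map_sum, map_sub, map_smul, smul_eq_mul, mul_comm]

theorem poisson_eq_fderiv : poisson f g z = fderiv ℝ f z (hamiltonianField g z) :=
  (map_hamiltonianField _).symm

theorem poisson_antisymm (f g : (Fin d → ℝ) × (Fin d → ℝ) → ℝ)
    (z : (Fin d → ℝ) × (Fin d → ℝ)) : poisson f g z = -poisson g f z := by
  simp only [poisson, ← Finset.sum_neg_distrib]
  exact Finset.sum_congr rfl fun m _ => by ring

theorem poisson_mul_left (hf : DifferentiableAt ℝ f z) (hg : DifferentiableAt ℝ g z) :
    poisson (fun w => f w * g w) h z = f z * poisson g h z + g z * poisson f h z := by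
  simp only [poisson_eq_fderiv, fderiv_fun_mul hf hg, add_apply, smul_apply, smul_eq_mul]

theorem poisson_sub_left (hf : DifferentiableAt ℝ f z) (hg : DifferentiableAt ℝ g z) :
    poisson (fun w => f w - g w) h z = poisson f h z - poisson g h z := by
  simp only [poisson_eq_fderiv, fderiv_fun_sub hf hg, sub_apply]

theorem poisson_const_mul_left (hf : DifferentiableAt ℝ f z) (c : ℝ) :
    poisson (fun w => c * f w) h z = c * poisson f h z := by
  simp only [poisson_eq_fderiv, fderiv_const_mul hf, smul_apply, smul_eq_mul]

theorem hasFDerivAt_poisson (hf : ContDiff ℝ 2 f) (hg : ContDiff ℝ 2 g)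
    (z : (Fin d → ℝ) × (Fin d → ℝ)) :
    HasFDerivAt (poisson f g)
      ((fderiv ℝ (fderiv ℝ f) z).flip (hamiltonianField g z) -
        (fderiv ℝ (fderiv ℝ g) z).flip (hamiltonianField f z)) z := by
  have hasFDerivAt_apply {k : (Fin d → ℝ) × (Fin d → ℝ) → ℝ} (hk : ContDiff ℝ 2 k)
      (v : (Fin d → ℝ) × (Fin d → ℝ)) :
      HasFDerivAt (fun w => fderiv ℝ k w v) ((fderiv ℝ (fderiv ℝ k) z).flip v) z := by
    have hd : Differentiable ℝ (fderiv ℝ k) :=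
      (hk.fderiv_right (m := 1) (by norm_num)).differentiable one_ne_zero
    exact (hd z).hasFDerivAt.clm_apply (hasFDerivAt_const v z) |>.congr_fderiv (by simp)
  have hsum := HasFDerivAt.fun_sum (u := Finset.univ) fun (m : Fin d) _ =>
    ((hasFDerivAt_apply hf (Pi.single m 1, 0)).mul (hasFDerivAt_apply hg (0, Pi.single m 1))).sub
      ((hasFDerivAt_apply hf (0, Pi.single m 1)).mul (hasFDerivAt_apply hg (Pi.single m 1, 0)))
  refine HasFDerivAt.congr_fderiv (f := poisson f g) hsum ?_
  refine ContinuousLinearMap.ext fun v => ?_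
  simp only [sub_apply, ContinuousLinearMap.flip_apply, map_hamiltonianField, sum_apply, add_apply,
    smul_apply, smul_eq_mul, ← Finset.sum_sub_distrib, pdX, pdP]
  exact Finset.sum_congr rfl fun m _ => by ring

theorem poisson_jacobi (hf : ContDiff ℝ 2 f) (hg : ContDiff ℝ 2 g) (hh : ContDiff ℝ 2 h)
    (z : (Fin d → ℝ) × (Fin d → ℝ)) :
    poisson (poisson f g) h z + poisson (poisson g h) f z + poisson (poisson h f) g z = 0 := by
  have second_symm {k : (Fin d → ℝ) × (Fin d → ℝ) → ℝ} (hk : ContDiff ℝ 2 k) :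
      IsSymmSndFDerivAt ℝ k z :=
    hk.contDiffAt.isSymmSndFDerivAt (by simp)
  simp only [poisson_eq_fderiv (f := poisson _ _), (hasFDerivAt_poisson hf hg z).fderiv,
    (hasFDerivAt_poisson hg hh z).fderiv, (hasFDerivAt_poisson hh hf z).fderiv,
    sub_apply, ContinuousLinearMap.flip_apply]
  rw [(second_symm hf).eq (hamiltonianField h z), (second_symm hg).eq (hamiltonianField h z),
    (second_symm hh).eq (hamiltonianField f z)]
  ring

theorem poisson_self (f : (Fin d → ℝ) × (Fin d → ℝ) → ℝ) (z : (Fin d → ℝ) × (Fin d → ℝ)) :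
    poisson f f z = 0 := by
  linarith [poisson_antisymm f f z]

end Bracket

/-- Classical trivial symmetries form an ideal:
(i) `(μH, −(1/2){μ,H})` is a global symmetry of `H`;
(ii) the covariance bracket of any global symmetry `(ε,a)` with a trivial one is again
trivial, with parameter `μ' = {ε,μ} − 2μa`. -/
theorem trivial_symmetries_ideal
    (d : ℕ) (H μ : (Fin d → ℝ) × (Fin d → ℝ) → ℝ)
    (hH : ContDiff ℝ 2 H) (hμ : ContDiff ℝ 2 μ) :
    (∀ z, 2 * (-(1 / 2) * poisson μ H z) * H z +
        poisson (fun w => μ w * H w) H z = 0) ∧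
    (∀ ε a : (Fin d → ℝ) × (Fin d → ℝ) → ℝ, ContDiff ℝ 2 ε → ContDiff ℝ 2 a →
      (∀ z, 2 * a z * H z + poisson ε H z = 0) →
      (∀ z, poisson ε (fun w => μ w * H w) z =
          (poisson ε μ z - 2 * μ z * a z) * H z) ∧
      (∀ z, poisson ε (fun w => -(1 / 2) * poisson μ H w) z -
            poisson (fun w => μ w * H w) a z =
          -(1 / 2) * poisson (fun w => poisson ε μ w - 2 * μ w * a w) H z)) := by
  have dH : Differentiable ℝ H := hH.differentiable two_ne_zero
  have dμ : Differentiable ℝ μ := hμ.differentiable two_ne_zero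
  refine ⟨fun z => ?_, fun ε a hε ha hsymm => ⟨fun z => ?_, fun z => ?_⟩⟩
  · rw [poisson_mul_left (dμ z) (dH z), poisson_self]
    ring
  · rw [poisson_antisymm, poisson_mul_left (dμ z) (dH z), poisson_antisymm H, poisson_antisymm μ]
    linear_combination μ z * hsymm z
  · have da : Differentiable ℝ a := ha.differentiable two_ne_zero
    have hHε : poisson H ε = fun w => 2 * (a w * H w) := by
      funext w
      linear_combination poisson_antisymm H ε w - hsymm w
    have hjac := poisson_jacobi hε hμ hH z
    rw [hHε, poisson_const_mul_left ((da z).fun_mul (dH z)),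
      poisson_mul_left (da z) (dH z)] at hjac
    have hassoc : (fun w => poisson ε μ w - 2 * μ w * a w) =
        fun w => poisson ε μ w - 2 * (μ w * a w) := by
      simp only [mul_assoc]
    rw [poisson_antisymm ε, hassoc,
      poisson_const_mul_left (hasFDerivAt_poisson hμ hH z).differentiableAt,
      poisson_mul_left (dμ z) (dH z),
      poisson_sub_left (hasFDerivAt_poisson hε hμ z).differentiableAt
        (((dμ z).fun_mul (da z)).const_mul 2),
      poisson_const_mul_left ((dμ z).fun_mul (da z)), poisson_mul_left (dμ z) (da z),
      poisson_antisymm H a, poisson_antisymm μ a]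
    rw [poisson_antisymm H μ] at hjac
    linear_combination (1 / 2) * hjac

end Stmt7
end

section
/- Classification of conformal Killing vectors of flat space (eqs. (glob0135), (glob134), (glob135)): let d ≥ 3 and let ξ : ℝ^d → ℝ^d be a C^∞ vector field. Then there exists a function α : ℝ^d → ℝ such that ∂_a ξ_b(x) + ∂_b ξ_a(x) = 2 α(x) δ_{ab} for all x ∈ ℝ^d and all 1 ≤ a,b ≤ d if and only if there exist a vector v ∈ ℝ^d, a skew-symmetric matrix Ω ∈ ℝ^{d×d}, a scalar c ∈ ℝ, and a vector k ∈ ℝ^d such that ξ(x) = v + Ω x + c x + ‖x‖² k − 2 ⟨k, x⟩ x for all x; in that case necessarily α(x) = c − 2 ⟨k, x⟩. -/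
namespace Stmt10

/-- partial derivative in the `a`-th coordinate direction of the `b`-th component of `ξ` -/
noncomputable def pd {d : ℕ} (g : (Fin d → ℝ) → ℝ) (a : Fin d) (x : Fin d → ℝ) : ℝ :=
  fderiv ℝ g x (Pi.single a 1)

/-- `ξ` satisfies the conformal Killing equation with conformal factor `α`:
`∂_a ξ_b + ∂_b ξ_a = 2 α δ_{ab}`. -/
def IsConformalKilling {d : ℕ} (ξ : (Fin d → ℝ) → Fin d → ℝ)
    (α : (Fin d → ℝ) → ℝ) : Prop :=
  ∀ (x : Fin d → ℝ) (a b : Fin d),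
    pd (fun y => ξ y b) a x + pd (fun y => ξ y a) b x =
      2 * α x * (if a = b then 1 else 0)

/-- `ξ` has the conformal form `ξ(x) = v + Ωx + cx + ‖x‖²k − 2⟨k,x⟩x`
with `Ω` skew-symmetric. -/
def HasConformalForm {d : ℕ} (ξ : (Fin d → ℝ) → Fin d → ℝ)
    (v : Fin d → ℝ) (Ω : Matrix (Fin d) (Fin d) ℝ) (c : ℝ) (k : Fin d → ℝ) : Prop :=
  (∀ a b, Ω a b = -Ω b a) ∧
  ∀ (x : Fin d → ℝ) (m : Fin d),
    ξ x m = v m + (∑ j, Ω m j * x j) + c * x m +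
      (∑ j, x j ^ 2) * k m - 2 * (∑ j, k j * x j) * x m

section PartialDerivatives

variable {d : ℕ} {f g : (Fin d → ℝ) → ℝ}

lemma pd_add (hf : Differentiable ℝ f) (hg : Differentiable ℝ g) (a : Fin d) (x : Fin d → ℝ) :
    pd (fun y => f y + g y) a x = pd f a x + pd g a x := by
  simp [pd, fderiv_fun_add (hf x) (hg x)]

lemma pd_sub (hf : Differentiable ℝ f) (hg : Differentiable ℝ g) (a : Fin d) (x : Fin d → ℝ) :
    pd (fun y => f y - g y) a x = pd f a x - pd g a x := by
  simp [pd, fderiv_fun_sub (hf x) (hg x)]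

lemma pd_mul (hf : Differentiable ℝ f) (hg : Differentiable ℝ g) (a : Fin d) (x : Fin d → ℝ) :
    pd (fun y => f y * g y) a x = f x * pd g a x + g x * pd f a x := by
  simp [pd, fderiv_fun_mul (hf x) (hg x)]

lemma pd_const (r : ℝ) (a : Fin d) (x : Fin d → ℝ) : pd (fun _ => r) a x = 0 := by
  simp [pd]

lemma pd_coord (i a : Fin d) (x : Fin d → ℝ) :
    pd (fun y => y i) a x = if a = i then 1 else 0 := by
  have h : HasFDerivAt (fun y : Fin d → ℝ => y i)
      (ContinuousLinearMap.proj (R := ℝ) (φ := fun _ : Fin d => ℝ) i) x :=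
    hasFDerivAt_apply i x
  simp [pd, h.fderiv, Pi.single_apply, eq_comm]

lemma pd_sum {F : Fin d → (Fin d → ℝ) → ℝ} (hF : ∀ j, Differentiable ℝ (F j))
    (a : Fin d) (x : Fin d → ℝ) :
    pd (fun y => ∑ j, F j y) a x = ∑ j, pd (F j) a x := by
  simp [pd, fderiv_fun_sum (fun j _ => hF j x)]

lemma pd_linear (w : Fin d → ℝ) (a : Fin d) (x : Fin d → ℝ) :
    pd (fun y => ∑ j, w j * y j) a x = w a := by
  rw [pd_sum (fun j => by fun_prop)]
  simp_rw [pd_mul (differentiable_const _) (differentiable_apply _), pd_coord, pd_const]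
  simp

lemma pd_normSq (a : Fin d) (x : Fin d → ℝ) :
    pd (fun y => ∑ j, y j ^ 2) a x = 2 * x a := by
  simp_rw [pow_two]
  rw [pd_sum (fun j => by fun_prop)]
  simp_rw [pd_mul (differentiable_apply _) (differentiable_apply _), pd_coord]
  simp [Finset.sum_add_distrib]
  ring

/-- The first partial derivatives of a component of a field in conformal form. -/
lemma pd_conformalForm (v : ℝ) (w : Fin d → ℝ) (c : ℝ) (k : Fin d → ℝ) (m a : Fin d)
    (x : Fin d → ℝ) :
    pd (fun y => v + (∑ j, w j * y j) + c * y m + (∑ j, y j ^ 2) * k m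
      - 2 * (∑ j, k j * y j) * y m) a x =
    w a + 2 * x a * k m - 2 * k a * x m
      + (c - 2 * ∑ j, k j * x j) * (if a = m then 1 else 0) := by
  rw [pd_sub (by fun_prop) (by fun_prop), pd_add (by fun_prop) (by fun_prop),
    pd_add (by fun_prop) (by fun_prop), pd_add (by fun_prop) (by fun_prop),
    pd_mul (by fun_prop) (by fun_prop), pd_mul (by fun_prop) (by fun_prop),
    pd_mul (by fun_prop) (by fun_prop), pd_mul (by fun_prop) (by fun_prop)]
  simp only [pd_const, pd_linear, pd_normSq, pd_coord]
  ring

lemma contDiff_pd (hg : ContDiff ℝ (⊤ : ℕ∞) g) (a : Fin d) :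
    ContDiff ℝ (⊤ : ℕ∞) (pd g a) :=
  (hg.fderiv_right (m := (⊤ : ℕ∞)) (by norm_cast)).clm_apply contDiff_const

lemma differentiable_of_contDiff_top (hg : ContDiff ℝ (⊤ : ℕ∞) g) : Differentiable ℝ g :=
  hg.differentiable (by simp)

lemma pd_comm (hg : ContDiff ℝ (⊤ : ℕ∞) g) (a b : Fin d) (x : Fin d → ℝ) :
    pd (pd g a) b x = pd (pd g b) a x := by
  have hd : DifferentiableAt ℝ (fderiv ℝ g) x :=
    (hg.fderiv_right (m := (⊤ : ℕ∞)) (by norm_cast)).differentiable (by simp) x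
  have key (a b : Fin d) : pd (pd g a) b x =
      fderiv ℝ (fderiv ℝ g) x (Pi.single b 1) (Pi.single a 1) := by
    unfold pd
    rw [fderiv_clm_apply hd (differentiableAt_const _)]
    simp
  rw [key, key]
  exact hg.contDiffAt.isSymmSndFDerivAt (by simp; norm_cast) _ _

/-- A differentiable function is determined by its partial derivatives and its value at `0`. -/
lemma eq_of_pd_eq (hf : Differentiable ℝ f) (hg : Differentiable ℝ g)
    (h : ∀ a x, pd f a x = pd g a x) (h0 : f 0 = g 0) : f = g := by
  refine eq_of_fderiv_eq (𝕜 := ℝ) hf hg (fun x => ?_) 0 h0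
  refine ContinuousLinearMap.coe_injective (LinearMap.pi_ext' fun a => ?_)
  ext
  simpa [pd] using h a x

/-- A differentiable function with constant partial derivatives is affine. -/
lemma eq_affine_of_pd_const (hf : Differentiable ℝ f) (w : Fin d → ℝ)
    (h : ∀ a x, pd f a x = w a) (x : Fin d → ℝ) : f x = f 0 + ∑ j, w j * x j := by
  refine congrFun (eq_of_pd_eq (g := fun y => f 0 + ∑ j, w j * y j) hf (by fun_prop)
    (fun a y => ?_) (by simp)) x
  rw [h, pd_add (by fun_prop) (by fun_prop), pd_const, pd_linear, zero_add]

end PartialDerivatives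

section ConformalKilling

variable {d : ℕ} {ξ : (Fin d → ℝ) → Fin d → ℝ} {α : (Fin d → ℝ) → ℝ}

lemma contDiff_component (hξ : ContDiff ℝ (⊤ : ℕ∞) ξ) (b : Fin d) :
    ContDiff ℝ (⊤ : ℕ∞) (fun y => ξ y b) :=
  contDiff_pi.1 hξ b

lemma IsConformalKilling.factor_eq (h : IsConformalKilling ξ α) (a : Fin d) (x : Fin d → ℝ) :
    α x = pd (fun y => ξ y a) a x := by
  have := h x a a
  simp only [if_true] at this
  linarith

lemma IsConformalKilling.contDiff_factor (h : IsConformalKilling ξ α)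
    (hξ : ContDiff ℝ (⊤ : ℕ∞) ξ) (a : Fin d) : ContDiff ℝ (⊤ : ℕ∞) α := by
  rw [funext (h.factor_eq a)]
  exact contDiff_pd (contDiff_component hξ a) a

/-- The second derivatives of a conformal Killing field in terms of the conformal factor. -/
lemma IsConformalKilling.pd_pd (h : IsConformalKilling ξ α) (hξ : ContDiff ℝ (⊤ : ℕ∞) ξ)
    (a b c : Fin d) (x : Fin d → ℝ) :
    pd (pd (fun y => ξ y c) b) a x =
      (if b = c then 1 else 0) * pd α a x + (if a = c then 1 else 0) * pd α b x
        - (if a = b then 1 else 0) * pd α c x := by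
  have hα := differentiable_of_contDiff_top (h.contDiff_factor hξ a)
  have hD (i j : Fin d) := differentiable_of_contDiff_top (contDiff_pd (contDiff_component hξ i) j)
  have S (e i j : Fin d) : pd (pd (fun y => ξ y j) i) e x + pd (pd (fun y => ξ y i) j) e x =
      2 * pd α e x * (if i = j then 1 else 0) := by
    have := congrArg (fun F => pd F e x) (funext fun y => h y i j)
    rw [pd_add (hD j i) (hD i j), pd_mul (by fun_prop) (by fun_prop),
      pd_mul (by fun_prop) hα] at this
    simp only [pd_const] at this
    linarith
  have C (e i j : Fin d) := pd_comm (contDiff_component hξ j) e i x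
  linarith [S a b c, S b a c, S c a b, C a b c, C a c b, C b c a]

lemma IsConformalKilling.pd_pd_factor (h : IsConformalKilling ξ α) (hξ : ContDiff ℝ (⊤ : ℕ∞) ξ)
    (hd : 3 ≤ d) (a b : Fin d) (x : Fin d → ℝ) : pd (pd α a) b x = 0 := by
  have hα := h.contDiff_factor hξ a
  have hA (i : Fin d) := differentiable_of_contDiff_top (contDiff_pd hα i)
  have T (e i j l : Fin d) : pd (pd (pd (fun y => ξ y l) j) i) e x =
      (if j = l then 1 else 0) * pd (pd α i) e x + (if i = l then 1 else 0) * pd (pd α j) e x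
        - (if i = j then 1 else 0) * pd (pd α l) e x := by
    have hm (r : ℝ) (i : Fin d) : Differentiable ℝ (fun y => r * pd α i y) := (hA i).const_mul r
    rw [funext (h.pd_pd hξ i j l), pd_sub (by exact (hm _ _).add (hm _ _)) (hm _ _),
      pd_add (hm _ _) (hm _ _)]
    simp only [pd_mul (differentiable_const _) (hA _), pd_const, mul_zero, add_zero]
  have key (i e j : Fin d) (hij : i ≠ j) (hie : i ≠ e) :
      pd (pd α j) e x = -((if e = j then 1 else 0) * pd (pd α i) i x) := by
    have := pd_comm (contDiff_pd (contDiff_component hξ i) j) i e x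
    rw [T, T] at this
    simp only [hij, hij.symm, hie.symm, if_true, if_false] at this
    linarith
  have third (i j : Fin d) : ∃ l, l ≠ i ∧ l ≠ j := by
    obtain ⟨l, hl⟩ := Finset.exists_mem_notMem_of_card_lt_card
      (s := {i, j}) (t := (Finset.univ : Finset (Fin d)))
      (lt_of_le_of_lt Finset.card_le_two (by rw [Finset.card_univ, Fintype.card_fin]; omega))
    exact ⟨l, by simpa using hl⟩
  obtain ⟨l, hla, hlb⟩ := third a b
  by_cases hab : b = a
  · subst hab
    obtain ⟨p, hpb, hpl⟩ := third b l
    have h₁ := key l b b hla hla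
    have h₂ := key p l l hpl hpl
    have h₃ := key p b b hpb hpb
    simp only [if_true, one_mul] at h₁ h₂ h₃
    linarith
  · simpa [hab] using key l b a hla hlb

lemma IsConformalKilling.hasConformalForm (h : IsConformalKilling ξ α)
    (hξ : ContDiff ℝ (⊤ : ℕ∞) ξ) (hd : 3 ≤ d) :
    HasConformalForm ξ (ξ 0)
      (fun m j => pd (fun y => ξ y m) j 0 - α 0 * (if j = m then 1 else 0))
      (α 0) (fun j => -(pd α j 0) / 2) := by
  have hα := h.contDiff_factor hξ ⟨0, by omega⟩
  have hA (a : Fin d) (x : Fin d → ℝ) : pd α a x = pd α a 0 := by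
    simpa using eq_affine_of_pd_const (differentiable_of_contDiff_top (contDiff_pd hα a)) 0
      (fun b y => h.pd_pd_factor hξ hd a b y) x
  refine ⟨fun a b => ?_, fun x m => ?_⟩
  · have := h 0 a b
    simp only [eq_comm (a := b) (b := a)]
    linarith
  · revert x
    refine funext_iff.1 (eq_of_pd_eq
      (differentiable_of_contDiff_top (contDiff_component hξ m)) (by fun_prop)
      (fun b y => ?_) (by simp))
    refine Eq.trans ?_ (pd_conformalForm (ξ 0 m)
      (fun j => pd (fun y => ξ y m) j 0 - α 0 * (if j = m then 1 else 0))
      (α 0) (fun j => -(pd α j 0) / 2) m b y).symm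
    rw [eq_affine_of_pd_const
      (differentiable_of_contDiff_top (contDiff_pd (contDiff_component hξ m) b))
      (fun a => (if b = m then 1 else 0) * pd α a 0 + (if a = m then 1 else 0) * pd α b 0
        - (if a = b then 1 else 0) * pd α m 0)
      (fun a z => by rw [h.pd_pd hξ, hA a, hA b, hA m]) y]
    have hs : ∑ j, -(pd α j 0) / 2 * y j = -(∑ j, pd α j 0 * y j) / 2 := by
      rw [neg_div, Finset.sum_div, ← Finset.sum_neg_distrib]
      exact Finset.sum_congr rfl fun j _ => by ring
    simp only [hs, sub_mul, add_mul, Finset.sum_sub_distrib, Finset.sum_add_distrib, mul_assoc,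
      ite_mul, one_mul, zero_mul, Finset.sum_ite_eq', Finset.mem_univ, if_true]
    split_ifs
    · ring
    · rw [Finset.sum_const_zero]
      ring

lemma HasConformalForm.pd_eq {v : Fin d → ℝ} {Ω : Matrix (Fin d) (Fin d) ℝ} {c : ℝ}
    {k : Fin d → ℝ} (h : HasConformalForm ξ v Ω c k) (m a : Fin d) (x : Fin d → ℝ) :
    pd (fun y => ξ y m) a x = Ω m a + 2 * x a * k m - 2 * k a * x m
      + (c - 2 * ∑ j, k j * x j) * (if a = m then 1 else 0) := by
  rw [funext fun y => h.2 y m, pd_conformalForm]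

lemma HasConformalForm.isConformalKilling {v : Fin d → ℝ} {Ω : Matrix (Fin d) (Fin d) ℝ} {c : ℝ}
    {k : Fin d → ℝ} (h : HasConformalForm ξ v Ω c k) :
    IsConformalKilling ξ (fun x => c - 2 * ∑ j, k j * x j) := by
  intro x a b
  rw [h.pd_eq, h.pd_eq, h.1 a b]
  simp only [eq_comm (a := b) (b := a)]
  ring

end ConformalKilling

/-- Classification of conformal Killing vectors of flat space, `d ≥ 3`:
a smooth vector field `ξ` admits a conformal factor `α` iff it is of the conformal
form; moreover in that case necessarily `α(x) = c − 2⟨k,x⟩`. -/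
theorem conformal_killing_classification
    (d : ℕ) (hd : 3 ≤ d) (ξ : (Fin d → ℝ) → Fin d → ℝ) (hξ : ContDiff ℝ (⊤ : ℕ∞) ξ) :
    ((∃ α : (Fin d → ℝ) → ℝ, IsConformalKilling ξ α) ↔
      (∃ (v : Fin d → ℝ) (Ω : Matrix (Fin d) (Fin d) ℝ) (c : ℝ) (k : Fin d → ℝ),
        HasConformalForm ξ v Ω c k)) ∧
    (∀ (α : (Fin d → ℝ) → ℝ), IsConformalKilling ξ α →
      ∀ (v : Fin d → ℝ) (Ω : Matrix (Fin d) (Fin d) ℝ) (c : ℝ) (k : Fin d → ℝ),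
        HasConformalForm ξ v Ω c k →
        ∀ x : Fin d → ℝ, α x = c - 2 * ∑ j, k j * x j) := by
  refine ⟨⟨fun ⟨α, h⟩ => ⟨_, _, _, _, h.hasConformalForm hξ hd⟩,
    fun ⟨v, Ω, c, k, h⟩ => ⟨_, h.isConformalKilling⟩⟩, fun α h v Ω c k hform x => ?_⟩
  have a : Fin d := ⟨0, by omega⟩
  rw [h.factor_eq a, hform.isConformalKilling.factor_eq a]

end Stmt10
end

section
/- Covariance of the Hamilton–Jacobi sigma model (eqs. (hjsm), (hullstrs), (newtrs)): let d ≥ 1 and let H, ε, a : ℝ^d × ℝ^d → ℝ and R, φ : ℝ^d → ℝ be C^∞ functions. Define δφ(x) = −ε(x, ∇φ(x)), δR(x) = −Σ_{m=1}^d ∂_m[ R · (∂ε/∂p_m)(·, ∇φ) ](x) − 2 a(x, ∇φ(x)) R(x), and δH = 2 a H + {ε, H}. Then for every x ∈ ℝ^d, the derivative at s = 0 of the Lagrangian (R(x) + s·δR(x)) · (H + s·δH)(x, ∇φ(x) + s·∇(δφ)(x)) exists and equals the total derivative −Σ_{m=1}^d ∂_m[ R · (∂ε/∂p_m)(·, ∇φ)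 · H(·, ∇φ) ](x). -/
namespace Stmt15

/-- partial derivative of a phase-space function in the `m`-th coordinate direction -/
noncomputable def pdX {d : ℕ} (f : (Fin d → ℝ) × (Fin d → ℝ) → ℝ) (m : Fin d)
    (z : (Fin d → ℝ) × (Fin d → ℝ)) : ℝ :=
  fderiv ℝ f z (Pi.single m 1, 0)

/-- partial derivative of a phase-space function in the `m`-th momentum direction -/
noncomputable def pdP {d : ℕ} (f : (Fin d → ℝ) × (Fin d → ℝ) → ℝ) (m : Fin d)
    (z : (Fin d → ℝ) × (Fin d → ℝ)) : ℝ :=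
  fderiv ℝ f z (0, Pi.single m 1)

/-- the Poisson bracket `{f,g} = Σ_m (∂f/∂x^m ∂g/∂p_m − ∂f/∂p_m ∂g/∂x^m)` -/
noncomputable def poisson {d : ℕ} (f g : (Fin d → ℝ) × (Fin d → ℝ) → ℝ)
    (z : (Fin d → ℝ) × (Fin d → ℝ)) : ℝ :=
  ∑ m : Fin d, (pdX f m z * pdP g m z - pdP f m z * pdX g m z)

/-- partial derivative of a function on `x`-space in the `m`-th direction -/
noncomputable def pdx {d : ℕ} (g : (Fin d → ℝ) → ℝ) (m : Fin d) (x : Fin d → ℝ) : ℝ :=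
  fderiv ℝ g x (Pi.single m 1)

/-- the gradient of a function on `x`-space -/
noncomputable def gradf {d : ℕ} (g : (Fin d → ℝ) → ℝ) (x : Fin d → ℝ) : Fin d → ℝ :=
  fun m => pdx g m x

theorem fderiv_apply_zero_right_eq_sum {d : ℕ} (F : (Fin d → ℝ) × (Fin d → ℝ) → ℝ)
    (z : (Fin d → ℝ) × (Fin d → ℝ)) (v : Fin d → ℝ) :
    fderiv ℝ F z (0, v) = ∑ k : Fin d, pdP F k z * v k := by
  have hv : ((0 : Fin d → ℝ), v) =
      ∑ k : Fin d, v k • ((0 : Fin d → ℝ), (Pi.single k 1 : Fin d → ℝ)) := by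
    refine Prod.ext ?_ ?_
    · simp [Prod.fst_sum]
    · rw [Prod.snd_sum]
      exact pi_eq_sum_univ' v
  rw [hv, map_sum]
  exact Finset.sum_congr rfl fun k _ => by rw [map_smul, smul_eq_mul, mul_comm, pdP]

/-- Chain rule for the restriction of a phase-space function to the graph of `g`. -/
theorem pdx_comp_graph {d : ℕ} {F : (Fin d → ℝ) × (Fin d → ℝ) → ℝ}
    {g : (Fin d → ℝ) → Fin d → ℝ} {x : Fin d → ℝ}
    (hF : DifferentiableAt ℝ F (x, g x)) (hg : DifferentiableAt ℝ g x) (m : Fin d) :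
    pdx (fun y => F (y, g y)) m x =
      pdX F m (x, g x) + ∑ k : Fin d, pdP F k (x, g x) * pdx (fun y => g y k) m x := by
  have h := hF.hasFDerivAt.comp x ((hasFDerivAt_id x).prodMk hg.hasFDerivAt)
  have hk : ∀ k, pdx (fun y => g y k) m x = fderiv ℝ g x (Pi.single m 1) k := fun k => by
    rw [pdx, (hasFDerivAt_pi'.1 hg.hasFDerivAt k).fderiv]
    rfl
  simp only [hk]
  rw [← fderiv_apply_zero_right_eq_sum, pdX, ← map_add, Prod.mk_add_mk, add_zero, zero_add]
  exact congrArg (fun L => L (Pi.single m 1)) h.fderiv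

theorem pdx_mul {d : ℕ} {f g : (Fin d → ℝ) → ℝ} {x : Fin d → ℝ}
    (hf : DifferentiableAt ℝ f x) (hg : DifferentiableAt ℝ g x) (m : Fin d) :
    pdx (fun y => f y * g y) m x = pdx f m x * g x + f x * pdx g m x := by
  have h := (hf.hasFDerivAt.mul hg.hasFDerivAt).fderiv
  rw [pdx, pdx, pdx]
  refine (congrArg (fun L => L (Pi.single m 1)) h).trans ?_
  simp only [add_apply, smul_apply, smul_eq_mul]
  ring

theorem pdx_neg {d : ℕ} (f : (Fin d → ℝ) → ℝ) (x : Fin d → ℝ) (m : Fin d) :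
    pdx (fun y => -f y) m x = -pdx f m x := by
  simp [pdx, fderiv_fun_neg]

theorem contDiff_pdX {d : ℕ} {F : (Fin d → ℝ) × (Fin d → ℝ) → ℝ}
    (hF : ContDiff ℝ (⊤ : ℕ∞) F) (m : Fin d) : ContDiff ℝ (⊤ : ℕ∞) (pdX F m) :=
  (hF.fderiv_right (m := (⊤ : ℕ∞)) le_rfl).clm_apply contDiff_const

theorem contDiff_pdP {d : ℕ} {F : (Fin d → ℝ) × (Fin d → ℝ) → ℝ}
    (hF : ContDiff ℝ (⊤ : ℕ∞) F) (m : Fin d) : ContDiff ℝ (⊤ : ℕ∞) (pdP F m) :=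
  (hF.fderiv_right (m := (⊤ : ℕ∞)) le_rfl).clm_apply contDiff_const

theorem contDiff_poisson {d : ℕ} {F G : (Fin d → ℝ) × (Fin d → ℝ) → ℝ}
    (hF : ContDiff ℝ (⊤ : ℕ∞) F) (hG : ContDiff ℝ (⊤ : ℕ∞) G) :
    ContDiff ℝ (⊤ : ℕ∞) (poisson F G) :=
  ContDiff.sum fun m _ => ((contDiff_pdX hF m).mul (contDiff_pdP hG m)).sub
    ((contDiff_pdP hF m).mul (contDiff_pdX hG m))

theorem contDiff_gradf {d : ℕ} {φ : (Fin d → ℝ) → ℝ} (hφ : ContDiff ℝ (⊤ : ℕ∞) φ) :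
    ContDiff ℝ (⊤ : ℕ∞) (gradf φ) :=
  contDiff_pi.2 fun _ => (hφ.fderiv_right (m := (⊤ : ℕ∞)) le_rfl).clm_apply contDiff_const

/-- Symmetry of the Hessian. -/
theorem pdx_gradf_comm {d : ℕ} {φ : (Fin d → ℝ) → ℝ} (hφ : ContDiff ℝ (⊤ : ℕ∞) φ)
    (x : Fin d → ℝ) (m k : Fin d) :
    pdx (fun y => gradf φ y k) m x = pdx (fun y => gradf φ y m) k x := by
  have hd : DifferentiableAt ℝ (fderiv ℝ φ) x :=
    (hφ.fderiv_right (m := (⊤ : ℕ∞)) le_rfl).differentiable (by simp) x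
  have h : ∀ i j, pdx (fun y => gradf φ y i) j x =
      fderiv ℝ (fderiv ℝ φ) x (Pi.single j 1) (Pi.single i 1) := fun i j => by
    simp only [pdx, gradf]
    rw [fderiv_clm_apply hd (differentiableAt_const _)]
    simp
  have h2 : minSmoothness ℝ 2 ≤ ((⊤ : ℕ∞) : WithTop ℕ∞) := by
    rw [minSmoothness_of_isRCLikeNormedField]
    exact WithTop.coe_le_coe.2 (le_top : (2 : ℕ∞) ≤ ⊤)
  rw [h, h]
  exact (hφ.contDiffAt.isSymmSndFDerivAt h2).eq _ _

/-- On the graph of `∇φ`, the Poisson bracket `{ε, H}` together with the variation of `H` induced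
by `δφ = -ε(·,∇φ)` is minus the derivative of `H(·,∇φ)` along `∂ε/∂p`. -/
theorem poisson_add_sum_pdP_mul_gradf {d : ℕ} {H ε : (Fin d → ℝ) × (Fin d → ℝ) → ℝ}
    {φ : (Fin d → ℝ) → ℝ} (hH : ContDiff ℝ (⊤ : ℕ∞) H) (hε : ContDiff ℝ (⊤ : ℕ∞) ε)
    (hφ : ContDiff ℝ (⊤ : ℕ∞) φ) (x : Fin d → ℝ) :
    poisson ε H (x, gradf φ x) +
        ∑ m : Fin d, pdP H m (x, gradf φ x) * gradf (fun y => -ε (y, gradf φ y)) x m =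
      -∑ m : Fin d, pdP ε m (x, gradf φ x) * pdx (fun y => H (y, gradf φ y)) m x := by
  have hg : DifferentiableAt ℝ (gradf φ) x := (contDiff_gradf hφ).differentiable (by simp) x
  have hswap : ∑ m : Fin d, ∑ k : Fin d, pdP H m (x, gradf φ x) *
        (pdP ε k (x, gradf φ x) * pdx (fun y => gradf φ y k) m x) =
      ∑ m : Fin d, ∑ k : Fin d, pdP ε m (x, gradf φ x) *
        (pdP H k (x, gradf φ x) * pdx (fun y => gradf φ y k) m x) := by
    rw [Finset.sum_comm]
    refine Finset.sum_congr rfl fun m _ => Finset.sum_congr rfl fun k _ => ?_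
    rw [pdx_gradf_comm hφ x k m]
    ring
  have hgrad : ∀ m, gradf (fun y => -ε (y, gradf φ y)) x m =
      -(pdX ε m (x, gradf φ x) +
        ∑ k : Fin d, pdP ε k (x, gradf φ x) * pdx (fun y => gradf φ y k) m x) := fun m => by
    rw [gradf, pdx_neg, pdx_comp_graph (hε.differentiable (by simp) _) hg]
  simp only [hgrad, pdx_comp_graph (hH.differentiable (by simp) _) hg, poisson, mul_neg, mul_add,
    Finset.sum_add_distrib, Finset.sum_neg_distrib, Finset.sum_sub_distrib, Finset.mul_sum]
  rw [hswap]
  simp only [mul_comm (pdP H _ _) (pdX ε _ _)]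
  ring

/-- Covariance of the Hamilton–Jacobi sigma model: with
`δφ = −ε(·,∇φ)`, `δR = −Σ_m ∂_m[R (∂ε/∂p_m)(·,∇φ)] − 2a(·,∇φ)R` and
`δH = 2aH + {ε,H}`, the derivative at `s = 0` of
`(R + sδR)(x) · (H + sδH)(x, ∇φ(x) + s∇(δφ)(x))` exists and equals the total
derivative `−Σ_m ∂_m[R (∂ε/∂p_m)(·,∇φ) H(·,∇φ)](x)`. -/
theorem hamilton_jacobi_covariance
    (d : ℕ) (hd : 1 ≤ d)
    (H ε a : (Fin d → ℝ) × (Fin d → ℝ) → ℝ) (R φ : (Fin d → ℝ) → ℝ)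
    (hH : ContDiff ℝ (⊤ : ℕ∞) H) (hε : ContDiff ℝ (⊤ : ℕ∞) ε) (ha : ContDiff ℝ (⊤ : ℕ∞) a)
    (hR : ContDiff ℝ (⊤ : ℕ∞) R) (hφ : ContDiff ℝ (⊤ : ℕ∞) φ)
    (x : Fin d → ℝ) :
    HasDerivAt
      (fun s : ℝ =>
        (R x + s * (-(∑ m : Fin d,
              pdx (fun y => R y * pdP ε m (y, gradf φ y)) m x) -
            2 * a (x, gradf φ x) * R x)) *
        ((fun z => H z + s * (2 * a z * H z + poisson ε H z))
          (x, gradf φ x + s • gradf (fun y => -ε (y, gradf φ y)) x)))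
      (-(∑ m : Fin d,
          pdx (fun y => R y * pdP ε m (y, gradf φ y) * H (y, gradf φ y)) m x))
      0 := by
  have hg := contDiff_gradf hφ
  have hgraph : ContDiff ℝ (⊤ : ℕ∞) fun y => (y, gradf φ y) := contDiff_id.prodMk hg
  have hne : ((⊤ : ℕ∞) : WithTop ℕ∞) ≠ 0 := by simp
  have hRd : Differentiable ℝ R := hR.differentiable hne
  have hεd : ∀ m, Differentiable ℝ fun y => pdP ε m (y, gradf φ y) := fun m =>
    ((contDiff_pdP hε m).comp hgraph).differentiable hne
  have hHd : Differentiable ℝ fun y => H (y, gradf φ y) := (hH.comp hgraph).differentiable hne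
  have hδH : ContDiff ℝ (⊤ : ℕ∞) fun z => 2 * a z * H z + poisson ε H z :=
    ((contDiff_const.mul ha).mul hH).add (contDiff_poisson hε hH)
  have hkey := poisson_add_sum_pdP_mul_gradf hH hε hφ x
  have hdiv : ∑ m : Fin d, pdx (fun y => R y * pdP ε m (y, gradf φ y) * H (y, gradf φ y)) m x =
      (∑ m : Fin d, pdx (fun y => R y * pdP ε m (y, gradf φ y)) m x) * H (x, gradf φ x) +
        R x * ∑ m : Fin d, pdP ε m (x, gradf φ x) * pdx (fun y => H (y, gradf φ y)) m x := by
    rw [Finset.sum_mul, Finset.mul_sum, ← Finset.sum_add_distrib]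
    refine Finset.sum_congr rfl fun m _ => ?_
    rw [pdx_mul ((hRd x).fun_mul (hεd m x)) (hHd x), mul_assoc (R x)]
  rw [hdiv]
  generalize (∑ m : Fin d, pdx (fun y => R y * pdP ε m (y, gradf φ y)) m x) = D
  generalize gradf (fun y => -ε (y, gradf φ y)) x = v at hkey ⊢
  have hpath : HasDerivAt (fun s : ℝ => (x, gradf φ x + s • v)) (0, v) 0 := by
    refine (hasDerivAt_const (0 : ℝ) x).prodMk ?_
    simpa using ((hasDerivAt_id (0 : ℝ)).smul_const v).const_add (gradf φ x)
  have hcomp : ∀ F : (Fin d → ℝ) × (Fin d → ℝ) → ℝ, ContDiff ℝ (⊤ : ℕ∞) F →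
      HasDerivAt (fun s : ℝ => F (x, gradf φ x + s • v))
        (fderiv ℝ F (x, gradf φ x) (0, v)) 0 := fun F hF => by
    refine HasFDerivAt.comp_hasDerivAt (0 : ℝ) ?_ hpath
    simpa using (hF.differentiable hne (x, gradf φ x)).hasFDerivAt
  have hRs := ((hasDerivAt_id (0 : ℝ)).mul_const (-D - 2 * a (x, gradf φ x) * R x)).const_add (R x)
  have hHs := (hcomp H hH).add ((hasDerivAt_id (0 : ℝ)).mul (hcomp _ hδH))
  refine (hRs.mul hHs).congr_deriv ?_
  rw [fderiv_apply_zero_right_eq_sum H]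
  simp only [id, Pi.add_apply, Pi.mul_apply, zero_smul, add_zero, zero_mul, one_mul]
  linear_combination R x * hkey

end Stmt15
end

section
/- Conservation of the Noether currents of the Hamilton–Jacobi sigma model (Sec. 9.2.6): let d ≥ 1 and let H, ε, a : ℝ^d × ℝ^d → ℝ and R, φ : ℝ^d → ℝ be C^∞ functions. Assume: (i) the global symmetry condition 2 a H + {ε, H} = 0 holds identically on ℝ^d × ℝ^d; (ii) the Hamilton–Jacobi equation H(x, ∇φ(x)) = 0 holds for all x ∈ ℝ^d; and (iii) the transport equation Σ_{m=1}^d ∂_m[ R · (∂H/∂p_m)(·, ∇φ) ](x) = 0 holds for all x ∈ ℝ^d. Then the Noether current J^m(x) = R(x) · ε(x, ∇φ(x)) · (∂H/∂p_m)(x, ∇φ(x)) is conserved: Σ_{m=1}^d ∂_m J^m(x) = 0 for all x ∈ ℝ^d. -/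
namespace Stmt16

/-- partial derivative of a phase-space function in the `m`-th coordinate direction -/
noncomputable def pdX {d : ℕ} (f : (Fin d → ℝ) × (Fin d → ℝ) → ℝ) (m : Fin d)
    (z : (Fin d → ℝ) × (Fin d → ℝ)) : ℝ :=
  fderiv ℝ f z (Pi.single m 1, 0)

/-- partial derivative of a phase-space function in the `m`-th momentum direction -/
noncomputable def pdP {d : ℕ} (f : (Fin d → ℝ) × (Fin d → ℝ) → ℝ) (m : Fin d)
    (z : (Fin d → ℝ) × (Fin d → ℝ)) : ℝ :=
  fderiv ℝ f z (0, Pi.single m 1)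

/-- the Poisson bracket `{f,g} = Σ_m (∂f/∂x^m ∂g/∂p_m − ∂f/∂p_m ∂g/∂x^m)` -/
noncomputable def poisson {d : ℕ} (f g : (Fin d → ℝ) × (Fin d → ℝ) → ℝ)
    (z : (Fin d → ℝ) × (Fin d → ℝ)) : ℝ :=
  ∑ m : Fin d, (pdX f m z * pdP g m z - pdP f m z * pdX g m z)

/-- partial derivative of a function on `x`-space in the `m`-th direction -/
noncomputable def pdx {d : ℕ} (g : (Fin d → ℝ) → ℝ) (m : Fin d) (x : Fin d → ℝ) : ℝ :=
  fderiv ℝ g x (Pi.single m 1)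

/-- the gradient of a function on `x`-space -/
noncomputable def gradf {d : ℕ} (g : (Fin d → ℝ) → ℝ) (x : Fin d → ℝ) : Fin d → ℝ :=
  fun m => pdx g m x

theorem differentiable_pdP {d : ℕ} {F : (Fin d → ℝ) × (Fin d → ℝ) → ℝ}
    (hF : ContDiff ℝ 2 F) (m : Fin d) : Differentiable ℝ (pdP F m) :=
  ((hF.fderiv_right (m := 1) (by norm_num)).differentiable (by norm_num)).clm_apply
    (differentiable_const _)

theorem differentiable_fderiv {d : ℕ} {φ : (Fin d → ℝ) → ℝ} (hφ : ContDiff ℝ 2 φ) :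
    Differentiable ℝ (fderiv ℝ φ) :=
  (hφ.fderiv_right (m := 1) (by norm_num)).differentiable (by norm_num)

theorem differentiable_pdx {d : ℕ} {φ : (Fin d → ℝ) → ℝ} (hφ : ContDiff ℝ 2 φ) (m : Fin d) :
    Differentiable ℝ (pdx φ m) :=
  (differentiable_fderiv hφ).clm_apply (differentiable_const _)

theorem differentiable_gradf {d : ℕ} {φ : (Fin d → ℝ) → ℝ} (hφ : ContDiff ℝ 2 φ) :
    Differentiable ℝ (gradf φ) :=
  differentiable_pi.2 (differentiable_pdx hφ)

/-- Symmetry of second partial derivatives. -/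
theorem pdx_pdx_comm {d : ℕ} {φ : (Fin d → ℝ) → ℝ} (hφ : ContDiff ℝ 2 φ)
    (m n : Fin d) (x : Fin d → ℝ) : pdx (pdx φ m) n x = pdx (pdx φ n) m x := by
  have key : ∀ i j : Fin d, pdx (pdx φ i) j x =
      fderiv ℝ (fderiv ℝ φ) x (Pi.single j 1) (Pi.single i 1) := by
    intro i j
    have h := ((differentiable_fderiv hφ x).hasFDerivAt.clm_apply
      (hasFDerivAt_const (Pi.single i (1 : ℝ)) x)).fderiv
    change fderiv ℝ (fun y => fderiv ℝ φ y (Pi.single i 1)) x (Pi.single j 1) = _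
    rw [h]
    simp
  rw [key, key]
  exact (hφ.contDiffAt.isSymmSndFDerivAt (by simp)).eq _ _

/-- Chain rule for a phase-space function restricted to the graph of `∇φ`. -/
theorem pdx_comp_gradf {d : ℕ} {F : (Fin d → ℝ) × (Fin d → ℝ) → ℝ} {φ : (Fin d → ℝ) → ℝ}
    (hF : Differentiable ℝ F) (hφ : ContDiff ℝ 2 φ) (m : Fin d) (x : Fin d → ℝ) :
    pdx (fun y => F (y, gradf φ y)) m x =
      pdX F m (x, gradf φ x) + ∑ n, pdP F n (x, gradf φ x) * pdx (pdx φ n) m x := by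
  have hg : HasFDerivAt (gradf φ) (ContinuousLinearMap.pi fun n => fderiv ℝ (pdx φ n) x) x :=
    hasFDerivAt_pi.2 fun n => (differentiable_pdx hφ n x).hasFDerivAt
  have h := ((hF (x, gradf φ x)).hasFDerivAt.comp x ((hasFDerivAt_id x).prodMk hg)).fderiv
  change fderiv ℝ (F ∘ fun y => (id y, gradf φ y)) x (Pi.single m 1) = _
  rw [h]
  have hv : ((Pi.single m 1 : Fin d → ℝ), fun n => pdx (pdx φ n) m x) =
      (Pi.single m 1, 0) +
        ∑ n, pdx (pdx φ n) m x • ((0 : Fin d → ℝ), (Pi.single n 1 : Fin d → ℝ)) := by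
    ext i
    · simp [Prod.fst_sum]
    · simp [Prod.snd_sum, Finset.sum_apply, Pi.single_apply]
  change fderiv ℝ F (x, gradf φ x) (Pi.single m 1, fun n => pdx (pdx φ n) m x) = _
  rw [hv, map_add, map_sum]
  simp only [map_smul, smul_eq_mul, pdX, pdP, mul_comm]

/-- On a solution of the Hamilton–Jacobi equation, the derivative of `F(·,∇φ)` along the
characteristic field `(∂H/∂p)(·,∇φ)` is the Poisson bracket `{F,H}`. -/
theorem sum_pdx_comp_gradf_mul_pdP {d : ℕ} {F H : (Fin d → ℝ) × (Fin d → ℝ) → ℝ}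
    {φ : (Fin d → ℝ) → ℝ} (hF : Differentiable ℝ F) (hH : Differentiable ℝ H)
    (hφ : ContDiff ℝ 2 φ) (hHJ : ∀ x, H (x, gradf φ x) = 0) (x : Fin d → ℝ) :
    ∑ m, pdx (fun y => F (y, gradf φ y)) m x * pdP H m (x, gradf φ x) =
      poisson F H (x, gradf φ x) := by
  have hX : ∀ n, ∑ m, pdP H m (x, gradf φ x) * pdx (pdx φ n) m x =
      -pdX H n (x, gradf φ x) := by
    intro n
    have h0 : pdx (fun y => H (y, gradf φ y)) n x = 0 := by
      simp [pdx, hHJ]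
    rw [pdx_comp_gradf hH hφ] at h0
    simp only [pdx_pdx_comm hφ n]
    linarith
  simp only [pdx_comp_gradf hF hφ, poisson, add_mul, Finset.sum_add_distrib,
    Finset.sum_sub_distrib, Finset.sum_mul]
  rw [Finset.sum_comm, sub_eq_add_neg, ← Finset.sum_neg_distrib]
  congr 1
  refine Finset.sum_congr rfl fun n _ => ?_
  rw [← mul_neg, ← hX n, Finset.mul_sum]
  exact Finset.sum_congr rfl fun m _ => by ring

theorem pdx_mul {d : ℕ} {f g : (Fin d → ℝ) → ℝ} (hf : Differentiable ℝ f)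
    (hg : Differentiable ℝ g) (m : Fin d) (x : Fin d → ℝ) :
    pdx (fun y => f y * g y) m x = f x * pdx g m x + pdx f m x * g x := by
  simp only [pdx]
  rw [fderiv_fun_mul (hf x) (hg x)]
  simp [mul_comm]

/-- Conservation of the Noether currents of the Hamilton–Jacobi sigma model:
assuming the global symmetry condition `2aH + {ε,H} = 0`, the Hamilton–Jacobi
equation `H(x,∇φ(x)) = 0` and the transport equation
`Σ_m ∂_m[R (∂H/∂p_m)(·,∇φ)] = 0`, the current
`J^m = R ε(·,∇φ)(∂H/∂p_m)(·,∇φ)` is conserved: `Σ_m ∂_m J^m = 0`. -/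
theorem hamilton_jacobi_noether_conservation
    (d : ℕ) (hd : 1 ≤ d)
    (H ε a : (Fin d → ℝ) × (Fin d → ℝ) → ℝ) (R φ : (Fin d → ℝ) → ℝ)
    (hH : ContDiff ℝ (⊤ : ℕ∞) H) (hε : ContDiff ℝ (⊤ : ℕ∞) ε) (ha : ContDiff ℝ (⊤ : ℕ∞) a)
    (hR : ContDiff ℝ (⊤ : ℕ∞) R) (hφ : ContDiff ℝ (⊤ : ℕ∞) φ)
    (hsym : ∀ z, 2 * a z * H z + poisson ε H z = 0)
    (hHJ : ∀ x : Fin d → ℝ, H (x, gradf φ x) = 0)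
    (htransport : ∀ x : Fin d → ℝ,
      (∑ m : Fin d, pdx (fun y => R y * pdP H m (y, gradf φ y)) m x) = 0) :
    ∀ x : Fin d → ℝ,
      (∑ m : Fin d,
        pdx (fun y => R y * ε (y, gradf φ y) * pdP H m (y, gradf φ y)) m x) = 0 := by
  intro x
  have two_le : (2 : WithTop ℕ∞) ≤ ((⊤ : ℕ∞) : WithTop ℕ∞) :=
    WithTop.coe_le_coe.2 le_top
  have hH2 := hH.of_le two_le
  have hφ2 := hφ.of_le two_le
  have hεd : Differentiable ℝ ε := (hε.of_le two_le).differentiable (by norm_num)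
  have hHd : Differentiable ℝ H := hH2.differentiable (by norm_num)
  have hRd : Differentiable ℝ R := (hR.of_le two_le).differentiable (by norm_num)
  have hgraph : Differentiable ℝ fun y => (y, gradf φ y) :=
    differentiable_id.prodMk (differentiable_gradf hφ2)
  have hJ : ∀ m, pdx (fun y => R y * ε (y, gradf φ y) * pdP H m (y, gradf φ y)) m x =
      ε (x, gradf φ x) * pdx (fun y => R y * pdP H m (y, gradf φ y)) m x +
        R x * (pdx (fun y => ε (y, gradf φ y)) m x * pdP H m (x, gradf φ x)) := by
    intro m
    have hcomm : (fun y => R y * ε (y, gradf φ y) * pdP H m (y, gradf φ y)) =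
        fun y => ε (y, gradf φ y) * (R y * pdP H m (y, gradf φ y)) := by
      funext y
      ring
    rw [hcomm, pdx_mul (f := fun y => ε (y, gradf φ y))
      (g := fun y => R y * pdP H m (y, gradf φ y)) (hεd.comp hgraph)
      (hRd.mul ((differentiable_pdP hH2 m).comp hgraph))]
    ring
  have hbracket := hsym (x, gradf φ x)
  rw [hHJ, mul_zero, zero_add] at hbracket
  simp only [hJ, Finset.sum_add_distrib, ← Finset.mul_sum]
  rw [htransport, sum_pdx_comp_gradf_mul_pdP hεd hHd hφ2 hHJ, hbracket]
  simp

end Stmt16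
end

section
/- The higher-spin-compensator transformation law realizes the algebra of canonical transformations (eq. (higgs1)): let E denote the Euler operator in momenta, (E f)(x,p) = Σ_{m=1}^d p_m (∂f/∂p_m)(x,p), and for a smooth ε : ℝ^d × ℝ^d → ℝ define the affine variation δ_ε β = {ε, β} + 2(1 − E)ε of a smooth function β on ℝ^d × ℝ^d. Then for all C² functions ε₁, ε₂, β on ℝ^d × ℝ^d the following identity of functions holds: {ε₂, {ε₁, β} + 2(1 − E)ε₁} − {ε₁, {ε₂, β} + 2(1 − E)ε₂} = {{ε₂, ε₁}, β} + 2(1 − E){ε₂, ε₁}; that is, the linearized commutator of δ_{ε₁} and δ_{ε₂} equals δ_{{ε₂,ε₁}}. -/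
namespace Stmt17

/-- partial derivative of a phase-space function in the `m`-th coordinate direction -/
noncomputable def pdX {d : ℕ} (f : (Fin d → ℝ) × (Fin d → ℝ) → ℝ) (m : Fin d)
    (z : (Fin d → ℝ) × (Fin d → ℝ)) : ℝ :=
  fderiv ℝ f z (Pi.single m 1, 0)

/-- partial derivative of a phase-space function in the `m`-th momentum direction -/
noncomputable def pdP {d : ℕ} (f : (Fin d → ℝ) × (Fin d → ℝ) → ℝ) (m : Fin d)
    (z : (Fin d → ℝ) × (Fin d → ℝ)) : ℝ :=
  fderiv ℝ f z (0, Pi.single m 1)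

/-- the Poisson bracket `{f,g} = Σ_m (∂f/∂x^m ∂g/∂p_m − ∂f/∂p_m ∂g/∂x^m)` -/
noncomputable def poisson {d : ℕ} (f g : (Fin d → ℝ) × (Fin d → ℝ) → ℝ)
    (z : (Fin d → ℝ) × (Fin d → ℝ)) : ℝ :=
  ∑ m : Fin d, (pdX f m z * pdP g m z - pdP f m z * pdX g m z)

/-- the Euler operator in momenta `(E f)(x,p) = Σ_m p_m ∂f/∂p_m` -/
noncomputable def Eop {d : ℕ} (f : (Fin d → ℝ) × (Fin d → ℝ) → ℝ)
    (z : (Fin d → ℝ) × (Fin d → ℝ)) : ℝ :=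
  ∑ m : Fin d, z.2 m * pdP f m z

/-- The symplectic map sending a covector `a` to the vector `(-∂a/∂p, ∂a/∂x)`. -/
noncomputable def symplecticSharp (d : ℕ) :
    (((Fin d → ℝ) × (Fin d → ℝ)) →L[ℝ] ℝ) →L[ℝ] ((Fin d → ℝ) × (Fin d → ℝ)) :=
  (ContinuousLinearMap.pi fun m =>
      -ContinuousLinearMap.apply ℝ ℝ ((0, Pi.single m 1) : (Fin d → ℝ) × (Fin d → ℝ))).prod
    (ContinuousLinearMap.pi fun m =>
      ContinuousLinearMap.apply ℝ ℝ ((Pi.single m 1, 0) : (Fin d → ℝ) × (Fin d → ℝ)))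

section

variable {d : ℕ}

lemma clm_apply_eq_sum (a : ((Fin d → ℝ) × (Fin d → ℝ)) →L[ℝ] ℝ)
    (u v : Fin d → ℝ) :
    a (u, v) = ∑ m, (u m * a (Pi.single m 1, 0) + v m * a (0, Pi.single m 1)) := by
  have expand (L : (Fin d → ℝ) →ₗ[ℝ] ℝ) (x : Fin d → ℝ) :
      L x = ∑ m, x m * L (Pi.single m 1) := by
    rw [LinearMap.pi_apply_eq_sum_univ L x]
    refine Finset.sum_congr rfl fun m _ => congrArg (fun y => x m * L y) (funext fun j => ?_)
    simp [Pi.single_apply, eq_comm]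
  have hu : a (u, 0) = ∑ m, u m * a (Pi.single m 1, 0) :=
    expand (a.toLinearMap ∘ₗ LinearMap.inl ℝ (Fin d → ℝ) (Fin d → ℝ)) u
  have hv : a (0, v) = ∑ m, v m * a (0, Pi.single m 1) :=
    expand (a.toLinearMap ∘ₗ LinearMap.inr ℝ (Fin d → ℝ) (Fin d → ℝ)) v
  rw [Finset.sum_add_distrib, ← hu, ← hv, ← map_add]
  simp

lemma apply_symplecticSharp (a b : ((Fin d → ℝ) × (Fin d → ℝ)) →L[ℝ] ℝ) :
    b (symplecticSharp d a) =
      ∑ m, (a (Pi.single m 1, 0) * b (0, Pi.single m 1) -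
        a (0, Pi.single m 1) * b (Pi.single m 1, 0)) := by
  refine (clm_apply_eq_sum b (symplecticSharp d a).1 (symplecticSharp d a).2).trans
    (Finset.sum_congr rfl fun m _ => ?_)
  simp only [symplecticSharp, ContinuousLinearMap.prod_apply, ContinuousLinearMap.coe_pi',
    neg_apply, ContinuousLinearMap.apply_apply]
  ring

lemma apply_symplecticSharp_antisymm (a b : ((Fin d → ℝ) × (Fin d → ℝ)) →L[ℝ] ℝ) :
    b (symplecticSharp d a) = -a (symplecticSharp d b) := by
  rw [apply_symplecticSharp, apply_symplecticSharp, ← Finset.sum_neg_distrib]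
  exact Finset.sum_congr rfl fun m _ => by ring

lemma apply_symplecticSharp_eq_momentum_sub
    (a b : ((Fin d → ℝ) × (Fin d → ℝ)) →L[ℝ] ℝ) :
    b (0, (symplecticSharp d a).2) - a (0, (symplecticSharp d b).2) =
      b (symplecticSharp d a) := by
  rw [clm_apply_eq_sum b, clm_apply_eq_sum a, apply_symplecticSharp, ← Finset.sum_sub_distrib]
  refine Finset.sum_congr rfl fun m _ => ?_
  simp only [symplecticSharp, ContinuousLinearMap.prod_apply, ContinuousLinearMap.coe_pi',
    ContinuousLinearMap.apply_apply, Pi.zero_apply]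
  ring

lemma poisson_eq (f g : (Fin d → ℝ) × (Fin d → ℝ) → ℝ) (z : (Fin d → ℝ) × (Fin d → ℝ)) :
    poisson f g z = fderiv ℝ g z (symplecticSharp d (fderiv ℝ f z)) :=
  (apply_symplecticSharp _ _).symm

lemma Eop_eq (f : (Fin d → ℝ) × (Fin d → ℝ) → ℝ) (z : (Fin d → ℝ) × (Fin d → ℝ)) :
    Eop f z = fderiv ℝ f z (0, z.2) := by
  rw [clm_apply_eq_sum]
  simp [Eop, pdP]

lemma hasFDerivAt_fderiv {f : (Fin d → ℝ) × (Fin d → ℝ) → ℝ} (hf : ContDiff ℝ 2 f)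
    (z : (Fin d → ℝ) × (Fin d → ℝ)) :
    HasFDerivAt (fderiv ℝ f) (fderiv ℝ (fderiv ℝ f) z) z :=
  ((hf.fderiv_right (m := 1) (by norm_num)).differentiable one_ne_zero z).hasFDerivAt

lemma fderiv_fderiv_comm {f : (Fin d → ℝ) × (Fin d → ℝ) → ℝ} (hf : ContDiff ℝ 2 f)
    (z u v : (Fin d → ℝ) × (Fin d → ℝ)) :
    fderiv ℝ (fderiv ℝ f) z u v = fderiv ℝ (fderiv ℝ f) z v u :=
  (hf.contDiffAt.isSymmSndFDerivAt (by simp)).eq u v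

lemma differentiableAt_poisson {f g : (Fin d → ℝ) × (Fin d → ℝ) → ℝ}
    (hf : ContDiff ℝ 2 f) (hg : ContDiff ℝ 2 g) (z : (Fin d → ℝ) × (Fin d → ℝ)) :
    DifferentiableAt ℝ (poisson f g) z := by
  rw [funext (poisson_eq f g)]
  exact ((hasFDerivAt_fderiv hg z).clm_apply
    ((symplecticSharp d).hasFDerivAt.comp z (hasFDerivAt_fderiv hf z))).differentiableAt

lemma fderiv_poisson {f g : (Fin d → ℝ) × (Fin d → ℝ) → ℝ}
    (hf : ContDiff ℝ 2 f) (hg : ContDiff ℝ 2 g) (z v : (Fin d → ℝ) × (Fin d → ℝ)) :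
    fderiv ℝ (poisson f g) z v =
      fderiv ℝ (fderiv ℝ g) z v (symplecticSharp d (fderiv ℝ f z)) -
        fderiv ℝ (fderiv ℝ f) z v (symplecticSharp d (fderiv ℝ g z)) := by
  have h := (hasFDerivAt_fderiv hg z).clm_apply
    ((symplecticSharp d).hasFDerivAt.comp z (hasFDerivAt_fderiv hf z))
  rw [funext (poisson_eq f g)]
  refine (congrArg (fun L => L v) h.fderiv).trans ?_
  simp only [add_apply, ContinuousLinearMap.comp_apply,
    ContinuousLinearMap.flip_apply, Function.comp_apply]
  rw [apply_symplecticSharp_antisymm (fderiv ℝ (fderiv ℝ f) z v)]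
  ring

lemma hasFDerivAt_Eop {f : (Fin d → ℝ) × (Fin d → ℝ) → ℝ} (hf : ContDiff ℝ 2 f)
    (z : (Fin d → ℝ) × (Fin d → ℝ)) :
    HasFDerivAt (Eop f)
      ((fderiv ℝ f z).comp ((ContinuousLinearMap.inr ℝ (Fin d → ℝ) (Fin d → ℝ)).comp
        (ContinuousLinearMap.snd ℝ (Fin d → ℝ) (Fin d → ℝ))) +
        (fderiv ℝ (fderiv ℝ f) z).flip (0, z.2)) z := by
  rw [funext (Eop_eq f)]
  exact (hasFDerivAt_fderiv hf z).clm_apply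
    ((ContinuousLinearMap.inr ℝ (Fin d → ℝ) (Fin d → ℝ)).comp
      (ContinuousLinearMap.snd ℝ (Fin d → ℝ) (Fin d → ℝ))).hasFDerivAt

lemma fderiv_compensator_variation {f g : (Fin d → ℝ) × (Fin d → ℝ) → ℝ}
    (hf : ContDiff ℝ 2 f) (hg : ContDiff ℝ 2 g) (z v : (Fin d → ℝ) × (Fin d → ℝ)) :
    fderiv ℝ (fun w => poisson f g w + 2 * (f w - Eop f w)) z v =
      fderiv ℝ (poisson f g) z v +
        2 * (fderiv ℝ f z v -
          (fderiv ℝ f z (0, v.2) + fderiv ℝ (fderiv ℝ f) z v (0, z.2))) := by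
  have h := (differentiableAt_poisson hf hg z).hasFDerivAt.add
    ((((hf.differentiable two_ne_zero z).hasFDerivAt).sub (hasFDerivAt_Eop hf z)).const_mul 2)
  refine (congrArg (fun L => L v) h.fderiv).trans ?_
  simp

end

/-- The higher-spin-compensator transformation law `δ_ε β = {ε,β} + 2(1−E)ε`
realizes the algebra of canonical transformations:
`{ε₂, {ε₁,β} + 2(1−E)ε₁} − {ε₁, {ε₂,β} + 2(1−E)ε₂} = {{ε₂,ε₁},β} + 2(1−E){ε₂,ε₁}`. -/
theorem compensator_transformation_algebra
    (d : ℕ) (ε₁ ε₂ β : (Fin d → ℝ) × (Fin d → ℝ) → ℝ)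
    (hε₁ : ContDiff ℝ 2 ε₁) (hε₂ : ContDiff ℝ 2 ε₂) (hβ : ContDiff ℝ 2 β)
    (z : (Fin d → ℝ) × (Fin d → ℝ)) :
    poisson ε₂ (fun w => poisson ε₁ β w + 2 * (ε₁ w - Eop ε₁ w)) z -
      poisson ε₁ (fun w => poisson ε₂ β w + 2 * (ε₂ w - Eop ε₂ w)) z =
    poisson (fun w => poisson ε₂ ε₁ w) β z +
      2 * (poisson ε₂ ε₁ z - Eop (fun w => poisson ε₂ ε₁ w) z) := by
  have swap := apply_symplecticSharp_antisymm (fderiv ℝ ε₁ z) (fderiv ℝ ε₂ z)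
  have momentum := apply_symplecticSharp_eq_momentum_sub (fderiv ℝ ε₂ z) (fderiv ℝ ε₁ z)
  rw [poisson_eq ε₂ (fun w => _), poisson_eq ε₁ (fun w => _), poisson_eq (fun w => _) β,
    Eop_eq, poisson_eq ε₂ ε₁ z, fderiv_compensator_variation hε₁ hβ,
    fderiv_compensator_variation hε₂ hβ, fderiv_poisson hε₁ hβ, fderiv_poisson hε₂ hβ,
    apply_symplecticSharp_antisymm _ (fderiv ℝ β z), fderiv_poisson hε₂ hε₁, fderiv_poisson hε₂ hε₁,
    fderiv_fderiv_comm hβ z (symplecticSharp d (fderiv ℝ ε₂ z)),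
    fderiv_fderiv_comm hε₁ z (symplecticSharp d (fderiv ℝ β z)),
    fderiv_fderiv_comm hε₂ z (symplecticSharp d (fderiv ℝ β z)),
    fderiv_fderiv_comm hε₁ z (0, z.2), fderiv_fderiv_comm hε₂ z (0, z.2)]
  linarith

end Stmt17
end

section
/- The operator 𝒩 built from the symplectic prepotential is a derivation of the Poisson algebra (Sec. 12.1): let β : ℝ^d × ℝ^d → ℝ be a C² function, let E be the Euler operator in momenta, and define (𝒩 ε) = (1/2){β, ε} + (E − 1)ε for C² functions ε on ℝ^d × ℝ^d. Then for all C² functions ε₁, ε₂: 𝒩{ε₁, ε₂} = {𝒩ε₁, ε₂} + {ε₁, 𝒩ε₂}. -/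
namespace Stmt18

/-- partial derivative of a phase-space function in the `m`-th coordinate direction -/
noncomputable def pdX {d : ℕ} (f : (Fin d → ℝ) × (Fin d → ℝ) → ℝ) (m : Fin d)
    (z : (Fin d → ℝ) × (Fin d → ℝ)) : ℝ :=
  fderiv ℝ f z (Pi.single m 1, 0)

/-- partial derivative of a phase-space function in the `m`-th momentum direction -/
noncomputable def pdP {d : ℕ} (f : (Fin d → ℝ) × (Fin d → ℝ) → ℝ) (m : Fin d)
    (z : (Fin d → ℝ) × (Fin d → ℝ)) : ℝ :=
  fderiv ℝ f z (0, Pi.single m 1)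

/-- the Poisson bracket `{f,g} = Σ_m (∂f/∂x^m ∂g/∂p_m − ∂f/∂p_m ∂g/∂x^m)` -/
noncomputable def poisson {d : ℕ} (f g : (Fin d → ℝ) × (Fin d → ℝ) → ℝ)
    (z : (Fin d → ℝ) × (Fin d → ℝ)) : ℝ :=
  ∑ m : Fin d, (pdX f m z * pdP g m z - pdP f m z * pdX g m z)

/-- the Euler operator in momenta `(E f)(x,p) = Σ_m p_m ∂f/∂p_m` -/
noncomputable def Eop {d : ℕ} (f : (Fin d → ℝ) × (Fin d → ℝ) → ℝ)
    (z : (Fin d → ℝ) × (Fin d → ℝ)) : ℝ :=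
  ∑ m : Fin d, z.2 m * pdP f m z

/-- the operator `𝒩 ε = (1/2){β,ε} + (E − 1)ε` built from the symplectic
prepotential `β` -/
noncomputable def Nop {d : ℕ} (β ε : (Fin d → ℝ) × (Fin d → ℝ) → ℝ) :
    (Fin d → ℝ) × (Fin d → ℝ) → ℝ :=
  fun z => (1 / 2) * poisson β ε z + (Eop ε z - ε z)

section Derivatives

variable {E : Type*} [NormedAddCommGroup E] [NormedSpace ℝ E] {f : E → ℝ}

theorem differentiableAt_fderiv_apply (hf : ContDiff ℝ 2 f) (u z : E) :
    DifferentiableAt ℝ (fun w => fderiv ℝ f w u) z :=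
  ((hf.fderiv_right (m := 1) (by norm_num)).differentiable one_ne_zero z).clm_apply
    (differentiableAt_const u)

theorem fderiv_fderiv_apply (hf : ContDiff ℝ 2 f) (u v z : E) :
    fderiv ℝ (fun w => fderiv ℝ f w u) z v = fderiv ℝ (fderiv ℝ f) z v u := by
  rw [fderiv_clm_apply ((hf.fderiv_right (m := 1) (by norm_num)).differentiable one_ne_zero z)
    (differentiableAt_const u)]
  simp

theorem fderiv_fderiv_comm (hf : ContDiff ℝ 2 f) (u v z : E) :
    fderiv ℝ (fderiv ℝ f) z u v = fderiv ℝ (fderiv ℝ f) z v u :=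
  hf.contDiffAt.isSymmSndFDerivAt (by simp) u v

end Derivatives

section PhaseSpace

variable {d : ℕ} {f g h : (Fin d → ℝ) × (Fin d → ℝ) → ℝ}

theorem differentiable_pdX (hf : ContDiff ℝ 2 f) (m : Fin d) : Differentiable ℝ (pdX f m) :=
  fun z => differentiableAt_fderiv_apply hf _ z

theorem differentiable_pdP (hf : ContDiff ℝ 2 f) (m : Fin d) : Differentiable ℝ (pdP f m) :=
  fun z => differentiableAt_fderiv_apply hf _ z

theorem differentiable_poisson (hf : ContDiff ℝ 2 f) (hg : ContDiff ℝ 2 g) :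
    Differentiable ℝ (poisson f g) :=
  Differentiable.fun_sum fun m _ =>
    ((differentiable_pdX hf m).mul (differentiable_pdP hg m)).sub
      ((differentiable_pdP hf m).mul (differentiable_pdX hg m))

theorem differentiable_momentum (m : Fin d) :
    Differentiable ℝ (fun w : (Fin d → ℝ) × (Fin d → ℝ) => w.2 m) := by
  fun_prop

theorem differentiable_Eop (hf : ContDiff ℝ 2 f) : Differentiable ℝ (Eop f) :=
  Differentiable.fun_sum fun m _ => (differentiable_momentum m).mul (differentiable_pdP hf m)

theorem fderiv_poisson (hf : ContDiff ℝ 2 f) (hg : ContDiff ℝ 2 g)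
    (z v : (Fin d → ℝ) × (Fin d → ℝ)) :
    fderiv ℝ (poisson f g) z v = ∑ m,
      (pdX f m z * fderiv ℝ (pdP g m) z v + pdP g m z * fderiv ℝ (pdX f m) z v -
        (pdP f m z * fderiv ℝ (pdX g m) z v + pdX g m z * fderiv ℝ (pdP f m) z v)) := by
  have hfX := fun m => differentiable_pdX hf m z
  have hfP := fun m => differentiable_pdP hf m z
  have hgX := fun m => differentiable_pdX hg m z
  have hgP := fun m => differentiable_pdP hg m z
  have key : HasFDerivAt (poisson f g) (∑ m,
      (pdX f m z • fderiv ℝ (pdP g m) z + pdP g m z • fderiv ℝ (pdX f m) z -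
        (pdP f m z • fderiv ℝ (pdX g m) z + pdX g m z • fderiv ℝ (pdP f m) z))) z :=
    HasFDerivAt.fun_sum fun m _ =>
      ((hfX m).hasFDerivAt.mul (hgP m).hasFDerivAt).sub
        ((hfP m).hasFDerivAt.mul (hgX m).hasFDerivAt)
  rw [key.fderiv]
  simp

theorem fderiv_Eop (hf : ContDiff ℝ 2 f) (z v : (Fin d → ℝ) × (Fin d → ℝ)) :
    fderiv ℝ (Eop f) z v = ∑ m, (z.2 m * fderiv ℝ (pdP f m) z v + pdP f m z * v.2 m) := by
  have hfP := fun m => differentiable_pdP hf m z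
  have hp (m : Fin d) : HasFDerivAt (fun w : (Fin d → ℝ) × (Fin d → ℝ) => w.2 m)
      ((ContinuousLinearMap.proj m).comp (ContinuousLinearMap.snd ℝ (Fin d → ℝ) (Fin d → ℝ))) z :=
    ((ContinuousLinearMap.proj (R := ℝ) (φ := fun _ : Fin d => ℝ) m).comp
      (ContinuousLinearMap.snd ℝ (Fin d → ℝ) (Fin d → ℝ))).hasFDerivAt
  have key : HasFDerivAt (Eop f) _ z :=
    HasFDerivAt.fun_sum (u := Finset.univ) fun m _ => (hp m).mul (hfP m).hasFDerivAt
  rw [key.fderiv]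
  simp

theorem fderiv_Nop (hg : ContDiff ℝ 2 g) (hf : ContDiff ℝ 2 f)
    (z v : (Fin d → ℝ) × (Fin d → ℝ)) :
    fderiv ℝ (Nop g f) z v =
      (1 / 2) * fderiv ℝ (poisson g f) z v + (fderiv ℝ (Eop f) z v - fderiv ℝ f z v) := by
  have key : HasFDerivAt (Nop g f) _ z :=
    ((differentiable_poisson hg hf z).hasFDerivAt.const_mul (1 / 2)).add
      ((differentiable_Eop hf z).hasFDerivAt.sub
        (hf.differentiable two_ne_zero z).hasFDerivAt)
  rw [key.fderiv]
  simp

theorem pdX_pdX_comm (hf : ContDiff ℝ 2 f) (m n : Fin d) (z : (Fin d → ℝ) × (Fin d → ℝ)) :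
    pdX (pdX f m) n z = pdX (pdX f n) m z :=
  (fderiv_fderiv_apply hf _ _ z).trans
    ((fderiv_fderiv_comm hf _ _ z).trans (fderiv_fderiv_apply hf _ _ z).symm)

theorem pdP_pdP_comm (hf : ContDiff ℝ 2 f) (m n : Fin d) (z : (Fin d → ℝ) × (Fin d → ℝ)) :
    pdP (pdP f m) n z = pdP (pdP f n) m z :=
  (fderiv_fderiv_apply hf _ _ z).trans
    ((fderiv_fderiv_comm hf _ _ z).trans (fderiv_fderiv_apply hf _ _ z).symm)

theorem pdX_pdP_comm (hf : ContDiff ℝ 2 f) (m n : Fin d) (z : (Fin d → ℝ) × (Fin d → ℝ)) :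
    pdX (pdP f m) n z = pdP (pdX f n) m z :=
  (fderiv_fderiv_apply hf _ _ z).trans
    ((fderiv_fderiv_comm hf _ _ z).trans (fderiv_fderiv_apply hf _ _ z).symm)

theorem pdX_poisson (hf : ContDiff ℝ 2 f) (hg : ContDiff ℝ 2 g) (n : Fin d)
    (z : (Fin d → ℝ) × (Fin d → ℝ)) :
    pdX (poisson f g) n z = ∑ m,
      (pdX f m z * pdX (pdP g m) n z + pdP g m z * pdX (pdX f m) n z -
        (pdP f m z * pdX (pdX g m) n z + pdX g m z * pdX (pdP f m) n z)) :=
  fderiv_poisson hf hg z _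

theorem pdP_poisson (hf : ContDiff ℝ 2 f) (hg : ContDiff ℝ 2 g) (n : Fin d)
    (z : (Fin d → ℝ) × (Fin d → ℝ)) :
    pdP (poisson f g) n z = ∑ m,
      (pdX f m z * pdP (pdP g m) n z + pdP g m z * pdP (pdX f m) n z -
        (pdP f m z * pdP (pdX g m) n z + pdX g m z * pdP (pdP f m) n z)) :=
  fderiv_poisson hf hg z _

theorem pdX_Eop (hf : ContDiff ℝ 2 f) (n : Fin d) (z : (Fin d → ℝ) × (Fin d → ℝ)) :
    pdX (Eop f) n z = ∑ m, z.2 m * pdX (pdP f m) n z := by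
  rw [pdX, fderiv_Eop hf]
  simp [pdX]

theorem pdP_Eop (hf : ContDiff ℝ 2 f) (n : Fin d) (z : (Fin d → ℝ) × (Fin d → ℝ)) :
    pdP (Eop f) n z = ∑ m, z.2 m * pdP (pdP f m) n z + pdP f n z := by
  rw [pdP, fderiv_Eop hf, Finset.sum_add_distrib]
  simp [pdP, Pi.single_apply]

/-- The Jacobi identity for the Poisson bracket, in derivation form. -/
theorem poisson_poisson (hf : ContDiff ℝ 2 f) (hg : ContDiff ℝ 2 g) (hh : ContDiff ℝ 2 h)
    (z : (Fin d → ℝ) × (Fin d → ℝ)) :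
    poisson f (poisson g h) z = poisson (poisson f g) h z + poisson g (poisson f h) z := by
  have split : poisson f (poisson g h) z =
      (∑ n, ∑ m, (pdX f n z * (pdP h m z * pdP (pdX g m) n z - pdX h m z * pdP (pdP g m) n z) -
        pdP f n z * (pdP h m z * pdX (pdX g m) n z - pdX h m z * pdX (pdP g m) n z))) +
      ∑ n, ∑ m, (pdX f n z * (pdX g m z * pdP (pdP h m) n z - pdP g m z * pdP (pdX h m) n z) -
        pdP f n z * (pdX g m z * pdX (pdP h m) n z - pdP g m z * pdX (pdX h m) n z)) := by
    simp only [poisson.eq_1 f, pdX_poisson hg hh, pdP_poisson hg hh, Finset.mul_sum,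
      ← Finset.sum_sub_distrib, ← Finset.sum_add_distrib]
    refine Finset.sum_congr rfl fun n _ => Finset.sum_congr rfl fun m _ => ?_
    ring
  have left : poisson (poisson f g) h z = ∑ n, ∑ m,
      ((pdX f m z * pdX (pdP g m) n z + pdP g m z * pdX (pdX f m) n z -
        (pdP f m z * pdX (pdX g m) n z + pdX g m z * pdX (pdP f m) n z)) * pdP h n z -
      (pdX f m z * pdP (pdP g m) n z + pdP g m z * pdP (pdX f m) n z -
        (pdP f m z * pdP (pdX g m) n z + pdX g m z * pdP (pdP f m) n z)) * pdX h n z) := by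
    simp only [poisson.eq_1 _ h, pdX_poisson hf hg, pdP_poisson hf hg, Finset.sum_mul,
      ← Finset.sum_sub_distrib]
  rw [split, left, Finset.sum_comm (f := fun n m => pdX f n z * (pdX g m z * _ - _) - _),
    Finset.sum_comm (f := fun n m => (_ : ℝ) * pdP h n z - _)]
  simp only [poisson.eq_1 g, pdX_poisson hf hh, pdP_poisson hf hh, Finset.mul_sum,
    ← Finset.sum_sub_distrib, ← Finset.sum_add_distrib]
  refine Finset.sum_congr rfl fun n _ => Finset.sum_congr rfl fun m _ => ?_
  simp only [pdX_pdP_comm hf, pdX_pdP_comm hg, pdX_pdP_comm hh]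
  rw [pdX_pdX_comm hf m n, pdX_pdX_comm hg m n, pdX_pdX_comm hh m n,
    pdP_pdP_comm hf m n, pdP_pdP_comm hg m n, pdP_pdP_comm hh m n]
  ring

/-- The Poisson bracket has degree `-1` in the momenta. -/
theorem Eop_poisson (hf : ContDiff ℝ 2 f) (hg : ContDiff ℝ 2 g)
    (z : (Fin d → ℝ) × (Fin d → ℝ)) :
    Eop (poisson f g) z + poisson f g z = poisson (Eop f) g z + poisson f (Eop g) z := by
  simp only [Eop.eq_1 (poisson f g), pdP_poisson hf hg, Finset.mul_sum]
  rw [Finset.sum_comm]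
  simp only [poisson, pdX_Eop hf, pdX_Eop hg, pdP_Eop hf, pdP_Eop hg,
    ← Finset.sum_add_distrib]
  refine Finset.sum_congr rfl fun n _ => ?_
  simp only [mul_add, add_mul, mul_sub, Finset.sum_add_distrib, Finset.sum_sub_distrib,
    Finset.mul_sum, Finset.sum_mul, pdX_pdP_comm hf, pdX_pdP_comm hg, pdP_pdP_comm hf n,
    pdP_pdP_comm hg n]
  simp only [mul_left_comm, mul_comm, mul_assoc]
  abel

theorem poisson_Nop_left (hh : ContDiff ℝ 2 h) (hf : ContDiff ℝ 2 f)
    (z : (Fin d → ℝ) × (Fin d → ℝ)) :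
    poisson (Nop h f) g z =
      (1 / 2) * poisson (poisson h f) g z + (poisson (Eop f) g z - poisson f g z) := by
  simp only [poisson.eq_1 _ g, pdX, pdP, fderiv_Nop hh hf, Finset.mul_sum,
    ← Finset.sum_sub_distrib, ← Finset.sum_add_distrib]
  exact Finset.sum_congr rfl fun n _ => by ring

theorem poisson_Nop_right (hh : ContDiff ℝ 2 h) (hg : ContDiff ℝ 2 g)
    (z : (Fin d → ℝ) × (Fin d → ℝ)) :
    poisson f (Nop h g) z =
      (1 / 2) * poisson f (poisson h g) z + (poisson f (Eop g) z - poisson f g z) := by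
  simp only [poisson.eq_1 f, pdX, pdP, fderiv_Nop hh hg, Finset.mul_sum,
    ← Finset.sum_sub_distrib, ← Finset.sum_add_distrib]
  exact Finset.sum_congr rfl fun n _ => by ring

end PhaseSpace

/-- The operator `𝒩` built from the symplectic prepotential is a derivation of the
Poisson algebra: `𝒩{ε₁,ε₂} = {𝒩ε₁,ε₂} + {ε₁,𝒩ε₂}`. -/
theorem Nop_is_derivation
    (d : ℕ) (β ε₁ ε₂ : (Fin d → ℝ) × (Fin d → ℝ) → ℝ)
    (hβ : ContDiff ℝ 2 β) (hε₁ : ContDiff ℝ 2 ε₁) (hε₂ : ContDiff ℝ 2 ε₂)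
    (z : (Fin d → ℝ) × (Fin d → ℝ)) :
    Nop β (fun w => poisson ε₁ ε₂ w) z =
      poisson (Nop β ε₁) ε₂ z + poisson ε₁ (Nop β ε₂) z := by
  rw [poisson_Nop_left hβ hε₁, poisson_Nop_right hβ hε₂]
  change (1 / 2) * poisson β (poisson ε₁ ε₂) z +
    (Eop (poisson ε₁ ε₂) z - poisson ε₁ ε₂ z) = _
  linear_combination (1 / 2) * poisson_poisson hβ hε₁ hε₂ z + Eop_poisson hε₁ hε₂ z

end Stmt18
end
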